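/- arXiv:1305.3336 — 4 statements merged into one kernel-verified Lean document; each statement's English description precedes it below -/
import Mathlib

section
/- For every integer k ≥ 1, set n = 2^{k+1}. There exists a rationalizable data set T over an n × n strategy space such that every bimatrix game (A,B) that rationalizes T satisfies rank(A+B) ≥ √(n/2). -/
/-- An observation: an observed choice `(i,j)` together with a subgame `(I,J)`. -/
abbrev Obs (n : ℕ) := (Fin n × Fin n) × Finset (Fin n) × Finset (Fin n)

/-- `T` is a (well-formed) data set: each observed choice lies in its subgame. -/
def IsDataset {n : ℕ} (T : Finset (Obs n)) : Prop :=
  ∀ o ∈ T, o.1.1 ∈ o.2.1 ∧ o.1.2 ∈ o.2.2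

/-- `(i,j)` is a strict Nash equilibrium of the subgame `(I,J)` of the bimatrix game `(A,B)`:
`A i j > A i' j` for all other `i' ∈ I` and `B i j > B i j'` for all other `j' ∈ J`. -/
def StrictNash {n : ℕ} (A B : Matrix (Fin n) (Fin n) ℝ)
    (I J : Finset (Fin n)) (i j : Fin n) : Prop :=
  i ∈ I ∧ j ∈ J ∧ (∀ i' ∈ I, i' ≠ i → A i' j < A i j) ∧ (∀ j' ∈ J, j' ≠ j → B i j' < B i j)

/-- The bimatrix game `(A,B)` rationalizes the data set `T`: every observed choice is a
strict Nash equilibrium of its subgame. -/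
def Rationalizes {n : ℕ} (A B : Matrix (Fin n) (Fin n) ℝ) (T : Finset (Obs n)) : Prop :=
  ∀ o ∈ T, StrictNash A B o.2.1 o.2.2 o.1.1 o.1.2

/-- The data set `T` is rationalizable by some bimatrix game. -/
def Rationalizable {n : ℕ} (T : Finset (Obs n)) : Prop :=
  ∃ A B : Matrix (Fin n) (Fin n) ℝ, Rationalizes A B T

open Matrix

theorem hasDerivAt_det_add_smul {m : Type*} [Fintype m] [DecidableEq m]
    {Q : Matrix m m ℝ} (hQ : IsUnit Q.det) (E : Matrix m m ℝ) :
    HasDerivAt (fun s : ℝ => (Q + s • E).det) (Q.det * (Q⁻¹ * E).trace) 0 := by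
  set p := (1 + (Polynomial.X : Polynomial ℝ) • (Q⁻¹ * E).map Polynomial.C).det with hp
  have h : ∀ s : ℝ, (Q + s • E).det = Q.det * p.eval s := by
    intro s
    have h1 : p.eval s = (1 + s • (Q⁻¹ * E)).det := by
      rw [hp]
      generalize Q⁻¹ * E = M
      rw [← Polynomial.coe_evalRingHom, RingHom.map_det]
      congr 1
      ext i j
      by_cases hij : i = j <;> simp [hij, mul_comm (M _ _)]
    rw [h1, ← Matrix.det_mul, mul_add, mul_one, Matrix.mul_smul, ← Matrix.mul_assoc,
      Matrix.mul_nonsing_inv _ hQ, Matrix.one_mul]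
  simp_rw [h]
  have h2 := (p.hasDerivAt 0).const_mul Q.det
  rwa [hp, Matrix.derivative_det_one_add_X_smul] at h2

theorem posDef_weighted_sum {ι m : Type*} [Fintype ι] [Nonempty ι] [Finite m]
    {E : ι → Matrix m m ℝ} (hE : ∀ i, (E i).PosDef) {c : ι → ℝ} (hc : ∀ i, 0 ≤ c i)
    (hpos : 0 < ∑ i, c i) : (∑ i, c i • E i).PosDef := by
  classical
  obtain ⟨i, -, hi⟩ := Finset.exists_lt_of_sum_lt (s := Finset.univ) (f := fun _ : ι => (0 : ℝ))
    (g := c) (by simpa using hpos)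
  rw [← Finset.add_sum_erase _ _ (Finset.mem_univ i)]
  exact ((hE i).smul hi).add_posSemidef
    (Matrix.posSemidef_sum _ fun j _ => (hE j).posSemidef.smul (hc j))

/-- Positive definite matrices can be rescaled, with weights summing to one, so that each
contributes the same trace relative to the weighted sum. -/
theorem exists_balancing_weights {ι m : Type*} [Fintype ι] [Nonempty ι]
    [Fintype m] [DecidableEq m] [Nonempty m]
    (E : ι → Matrix m m ℝ) (hE : ∀ i, (E i).PosDef) :
    ∃ c : ι → ℝ, (∀ i, 0 < c i) ∧ ∑ i, c i = 1 ∧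
      ∀ i, Fintype.card ι * (c i * ((∑ j, c j • E j)⁻¹ * E i).trace) = Fintype.card m := by
  classical
  set N := Fintype.card ι with hN
  set d := Fintype.card m with hd
  have hNpos : 0 < N := Fintype.card_pos
  have hdpos : 0 < d := Fintype.card_pos
  set Q : (ι → ℝ) → Matrix m m ℝ := fun c => ∑ j, c j • E j with hQ
  have hdet : ∀ c : ι → ℝ, (∀ i, 0 ≤ c i) → 0 < ∑ i, c i → 0 < (Q c).det := fun c h1 h2 =>
    (posDef_weighted_sum hE h1 h2).det_pos
  have hsimp : ∀ c ∈ stdSimplex ℝ ι, 0 < (Q c).det := fun c h =>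
    hdet c h.1 (by rw [h.2]; norm_num)
  set f : (ι → ℝ) → ℝ := fun c => (∏ i, c i) ^ d / (Q c).det ^ N with hf
  have hcont : ContinuousOn f (stdSimplex ℝ ι) := by
    apply ContinuousOn.div
    · fun_prop
    · refine Continuous.continuousOn (Continuous.pow (Continuous.matrix_det ?_) _)
      exact continuous_finsetSum _ fun i _ => (continuous_apply i).smul continuous_const
    · exact fun c hc => (pow_pos (hsimp c hc) _).ne'
  have hu : (fun _ => (N : ℝ)⁻¹) ∈ stdSimplex ℝ ι := by
    refine ⟨fun _ => by positivity, ?_⟩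
    simp [← hN, hNpos.ne']
  obtain ⟨c, hc, hmax⟩ := (isCompact_stdSimplex ℝ ι).exists_isMaxOn ⟨_, hu⟩ hcont
  have hfpos : 0 < f c := by
    refine lt_of_lt_of_le ?_ (hmax hu)
    exact div_pos (pow_pos (Finset.prod_pos fun i _ => by positivity) _)
      (pow_pos (hsimp _ hu) _)
  have hcpos : ∀ i, 0 < c i := by
    intro i
    refine lt_of_le_of_ne (hc.1 i) fun h => hfpos.ne' ?_
    simp [hf, Finset.prod_eq_zero (Finset.mem_univ i) h.symm, hdpos.ne']
  have hglobal : ∀ b : ι → ℝ, (∀ i, 0 ≤ b i) → 0 < ∑ i, b i → f b ≤ f c := by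
    intro b hb hb'
    set l := ∑ i, b i with hl
    have hmem : (l⁻¹ • b) ∈ stdSimplex ℝ ι := by
      refine ⟨fun i => mul_nonneg (inv_nonneg.2 hb'.le) (hb i), ?_⟩
      simp [← Finset.mul_sum, ← hl, hb'.ne']
    have hQl : Q (l⁻¹ • b) = l⁻¹ • Q b := by
      simp [hQ, Finset.smul_sum, smul_smul]
    have : f (l⁻¹ • b) = f b := by
      simp only [hf, hQl, Matrix.det_smul, Pi.smul_apply, smul_eq_mul, Finset.prod_mul_distrib,
        Finset.prod_const, Finset.card_univ, ← hN, ← hd, mul_pow, ← pow_mul, mul_comm d N]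
      exact mul_div_mul_left _ _ (by positivity)
    exact this ▸ hmax hmem
  have hprod : 0 < ∏ i, c i := Finset.prod_pos fun i _ => hcpos i
  have hD := hsimp c hc
  refine ⟨c, hcpos, hc.2, fun i => ?_⟩
  have hloc : ∀ s : ℝ, -1 < s →
      (1 + s) ^ d * (Q c).det ^ N ≤ (Q c + s • (c i • E i)).det ^ N := by
    intro s hs
    set b := Function.update c i ((1 + s) * c i) with hb
    have hbpos : ∀ j, 0 < b j := by
      intro j
      by_cases hj : j = i
      · subst hj; simpa [hb] using mul_pos (by linarith) (hcpos j)
      · simpa [hb, hj] using hcpos j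
    have hbs : 0 < ∑ j, b j := Finset.sum_pos (fun j _ => hbpos j) Finset.univ_nonempty
    have hQb : Q b = Q c + s • (c i • E i) := by
      simp only [hQ]
      rw [← Finset.add_sum_erase _ _ (Finset.mem_univ i),
        ← Finset.add_sum_erase _ (fun j => c j • E j) (Finset.mem_univ i),
        Finset.sum_congr rfl (g := fun j => c j • E j)]
      · simp only [hb, Function.update_self, smul_smul]
        module
      · intro j hj
        simp [hb, Finset.ne_of_mem_erase hj]
    have hpb : ∏ j, b j = (1 + s) * ∏ j, c j := by
      rw [hb, Finset.prod_update_of_mem (Finset.mem_univ i), mul_assoc,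
        Finset.sdiff_singleton_eq_erase, ← Finset.mul_prod_erase _ c (Finset.mem_univ i)]
    have h1 := hglobal b (fun j => (hbpos j).le) hbs
    have h2 := hdet b (fun j => (hbpos j).le) hbs
    simp only [hf, hpb] at h1
    rw [div_le_div_iff₀ (pow_pos h2 _) (pow_pos hD _), mul_pow] at h1
    rw [← hQb]
    have h3 : 0 < (∏ j, c j) ^ d := by positivity
    nlinarith
  have hder : HasDerivAt
      (fun s : ℝ => (Q c + s • (c i • E i)).det ^ N - (1 + s) ^ d * (Q c).det ^ N)
      (N * (Q c).det ^ (N - 1) * ((Q c).det * ((Q c)⁻¹ * (c i • E i)).trace)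
        - d * (Q c).det ^ N) 0 := by
    have h1 := (hasDerivAt_det_add_smul (Q := Q c) hD.ne'.isUnit (c i • E i)).pow N
    have h2 := ((((hasDerivAt_id (0 : ℝ)).const_add 1).pow d).mul_const ((Q c).det ^ N))
    convert! h1.sub h2 using 1
    simp
  have hmin : IsLocalMin
      (fun s : ℝ => (Q c + s • (c i • E i)).det ^ N - (1 + s) ^ d * (Q c).det ^ N) 0 := by
    filter_upwards [lt_mem_nhds (show (-1 : ℝ) < 0 by norm_num)] with s hs
    simpa using hloc s hs
  have h0 := hmin.hasDerivAt_eq_zero hder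
  have hpow : (Q c).det ^ N = (Q c).det ^ (N - 1) * (Q c).det := by
    rw [← pow_succ, Nat.sub_add_cancel hNpos]
  rw [Matrix.mul_smul, Matrix.trace_smul, smul_eq_mul, hpow] at h0
  have h3 : (0 : ℝ) < (Q c).det ^ (N - 1) * (Q c).det := by positivity
  refine mul_left_cancel₀ h3.ne' ?_
  linear_combination h0

theorem sq_dotProduct_le_of_posDef {m : Type*} [Fintype m] [DecidableEq m]
    {Q : Matrix m m ℝ} (hQ : Q.PosDef) (u w : m → ℝ) :
    (u ⬝ᵥ w) ^ 2 ≤ (u ⬝ᵥ Q⁻¹ *ᵥ u) * (w ⬝ᵥ Q *ᵥ w) := by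
  have hdet : IsUnit Q.det := hQ.det_pos.ne'.isUnit
  have hsymm : Qᵀ = Q := 
    (Matrix.conjTranspose_eq_transpose_of_trivial Q).symm.trans hQ.isHermitian
  have hQu : Q *ᵥ (Q⁻¹ *ᵥ u) = u := by
    rw [Matrix.mulVec_mulVec, Matrix.mul_nonsing_inv _ hdet, Matrix.one_mulVec]
  have hcross : (Q⁻¹ *ᵥ u) ⬝ᵥ Q *ᵥ w = u ⬝ᵥ w := by
    rw [Matrix.dotProduct_mulVec, ← Matrix.mulVec_transpose, hsymm, hQu]
  have h : ∀ t : ℝ, 0 ≤ (u ⬝ᵥ Q⁻¹ *ᵥ u) * (t * t) + (-2 * (u ⬝ᵥ w)) * t + w ⬝ᵥ Q *ᵥ w := by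
    intro t
    have h1 := hQ.posSemidef.dotProduct_mulVec_nonneg (w - t • (Q⁻¹ *ᵥ u))
    simp only [star_trivial, Matrix.mulVec_sub, Matrix.mulVec_smul, hQu, dotProduct_sub,
      sub_dotProduct, dotProduct_smul, smul_dotProduct, smul_eq_mul, hcross] at h1
    rw [dotProduct_comm w u, dotProduct_comm (Q⁻¹ *ᵥ u) u] at h1
    linarith
  have h2 := discrim_le_zero h
  rw [discrim] at h2
  linarith

/-- A form of Forster's bound: a sign matrix with orthogonal rows of length `card ι` is not
the sign pattern of a matrix that factors through a space of dimension less than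
`√(card ι)`. -/
theorem card_le_sq_of_sign_factorization {ι m : Type*} [Fintype ι] [DecidableEq ι] [Nonempty ι]
    [Fintype m] (H : Matrix ι ι ℝ)
    (hH : H * Hᵀ = (Fintype.card ι : ℝ) • 1) (habs : ∀ i j, |H i j| = 1)
    (x y : ι → m → ℝ) (hxy : ∀ i j, 0 < H i j * (x i ⬝ᵥ y j)) :
    Fintype.card ι ≤ Fintype.card m ^ 2 := by
  classical
  set N := Fintype.card ι with hN
  set d := Fintype.card m with hd
  have hNpos : 0 < N := Fintype.card_pos
  have : Nonempty m := by
    by_contra hm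
    rw [not_nonempty_iff] at hm
    have := hxy (Classical.arbitrary ι) (Classical.arbitrary ι)
    simp [dotProduct] at this
  have hdpos : 0 < d := Fintype.card_pos
  have key : ∀ δ : ℝ, 0 < δ → δ < 1 → (1 - δ) ^ 2 * N ≤ (d : ℝ) ^ 2 := by
    intro δ hδ hδ1
    obtain ⟨ε, hε, hεxy⟩ : ∃ ε : ℝ, 0 < ε ∧
        ∀ i j, ε * (y j ⬝ᵥ y j) ≤ δ * (x i ⬝ᵥ y j) ^ 2 := by
      have h : ∀ᶠ ε : ℝ in nhdsWithin 0 (Set.Ioi 0), ∀ i j,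
          ε * (y j ⬝ᵥ y j) ≤ δ * (x i ⬝ᵥ y j) ^ 2 := by
        refine Filter.eventually_all.2 fun i => Filter.eventually_all.2 fun j => ?_
        have h1 : Filter.Tendsto (fun ε : ℝ => ε * (y j ⬝ᵥ y j)) (nhdsWithin 0 (Set.Ioi 0))
            (nhds 0) := by
          refine tendsto_nhdsWithin_of_tendsto_nhds ?_
          exact Continuous.tendsto' (by fun_prop) _ _ (zero_mul _)
        have h2 : (x i ⬝ᵥ y j) ≠ 0 := right_ne_zero_of_mul (hxy i j).ne'
        filter_upwards [h1.eventually_lt_const (show 0 < δ * (x i ⬝ᵥ y j) ^ 2 by positivity)]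
          with ε hε using hε.le
      obtain ⟨ε, h1, h2⟩ := (h.and self_mem_nhdsWithin).exists
      exact ⟨ε, h2, h1⟩
    set E : ι → Matrix m m ℝ := fun i => ε • 1 + vecMulVec (x i) (x i) with hE
    have hEpos : ∀ i, (E i).PosDef := fun i =>
      (Matrix.PosDef.one.smul hε).add_posSemidef
        (by simpa using Matrix.posSemidef_vecMulVec_self_star (x i))
    obtain ⟨c, hc, hc1, hbal⟩ := exists_balancing_weights E hEpos
    set Q := ∑ j, c j • E j with hQdef
    have hQ : Q.PosDef := posDef_weighted_sum hEpos (fun i => (hc i).le) (by rw [hc1]; norm_num)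
    have hquad : ∀ w : m → ℝ,
        w ⬝ᵥ Q *ᵥ w = ε * (w ⬝ᵥ w) + ∑ i, c i * (x i ⬝ᵥ w) ^ 2 := by
      intro w
      have h1 : ∀ i, w ⬝ᵥ (c i • E i) *ᵥ w = c i * (ε * (w ⬝ᵥ w)) + c i * (x i ⬝ᵥ w) ^ 2 := by
        intro i
        simp only [hE, Matrix.smul_mulVec, Matrix.add_mulVec, Matrix.one_mulVec,
          Matrix.vecMulVec_mulVec, dotProduct_smul, dotProduct_add, smul_eq_mul,
          op_smul_eq_smul]
        rw [dotProduct_comm w (x i)]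
        ring
      rw [hQdef, Matrix.sum_mulVec, dotProduct_sum, Finset.sum_congr rfl fun i _ => h1 i,
        Finset.sum_add_distrib, ← Finset.sum_mul, hc1, one_mul]
    have hlev : ∀ i, N * (c i * (x i ⬝ᵥ Q⁻¹ *ᵥ x i)) ≤ d := by
      intro i
      rw [← hbal i]
      have h1 : (Q⁻¹ * E i).trace = ε * (Q⁻¹).trace + x i ⬝ᵥ Q⁻¹ *ᵥ x i := by
        simp only [hE, Matrix.mul_add, Matrix.mul_smul, Matrix.mul_one, Matrix.trace_add,
          Matrix.trace_smul, smul_eq_mul, Matrix.mul_vecMulVec, Matrix.trace_vecMulVec]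
        rw [dotProduct_comm]
      have h2 : 0 ≤ (Q⁻¹).trace := hQ.inv.posSemidef.trace_nonneg
      rw [h1]
      have := (hc i).le
      gcongr
      nlinarith [mul_nonneg hε.le h2]
    set g : ι → m → ℝ := fun j => ∑ i, (√(c i) * H i j) • x i with hg
    have hcol : ∀ j, (1 - δ) ^ 2 * N ≤ d * (g j ⬝ᵥ Q⁻¹ *ᵥ g j) := by
      intro j
      set α := y j ⬝ᵥ Q *ᵥ y j with hα
      set β := ∑ i, c i * (x i ⬝ᵥ y j) ^ 2 with hβ
      have hβα : (1 - δ) * α ≤ β := by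
        have h1 : ε * (y j ⬝ᵥ y j) ≤ δ * β := by
          calc ε * (y j ⬝ᵥ y j) = ∑ i, c i * (ε * (y j ⬝ᵥ y j)) := by
                rw [← Finset.sum_mul, hc1, one_mul]
            _ ≤ ∑ i, c i * (δ * (x i ⬝ᵥ y j) ^ 2) :=
                Finset.sum_le_sum fun i _ => mul_le_mul_of_nonneg_left (hεxy i j) (hc i).le
            _ = δ * β := by
                rw [hβ, Finset.mul_sum]
                exact Finset.sum_congr rfl fun i _ => by ring
        have h2 : α = ε * (y j ⬝ᵥ y j) + β := hquad (y j)
        have h3 : 0 ≤ ε * (y j ⬝ᵥ y j) :=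
          mul_nonneg hε.le (by simpa using dotProduct_star_self_nonneg (y j))
        nlinarith
      have hβpos : 0 < β := Finset.sum_pos (fun i _ => by
        have : (x i ⬝ᵥ y j) ≠ 0 := right_ne_zero_of_mul (hxy i j).ne'
        have := hc i
        positivity) Finset.univ_nonempty
      have hαpos : 0 < α := by
        have h2 : α = ε * (y j ⬝ᵥ y j) + β := hquad (y j)
        have h3 : 0 ≤ ε * (y j ⬝ᵥ y j) :=
          mul_nonneg hε.le (by simpa using dotProduct_star_self_nonneg (y j))
        linarith
      set r : ι → ℝ := fun i => √(c i) * (H i j * (x i ⬝ᵥ y j)) with hr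
      have hr0 : ∀ i, 0 ≤ r i := fun i => mul_nonneg (Real.sqrt_nonneg _) (hxy i j).le
      have hr2 : ∀ i, r i ^ 2 = c i * (x i ⬝ᵥ y j) ^ 2 := by
        intro i
        have h1 : H i j ^ 2 = 1 := by rw [← sq_abs, habs, one_pow]
        rw [hr, mul_pow, mul_pow, Real.sq_sqrt (hc i).le, h1, one_mul]
      have hrle : ∀ i, r i ≤ √(d / N * α) := by
        intro i
        refine Real.le_sqrt_of_sq_le ?_
        rw [hr2]
        have h1 := sq_dotProduct_le_of_posDef hQ (x i) (y j)
        have h2 : c i * (x i ⬝ᵥ Q⁻¹ *ᵥ x i) ≤ d / N := by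
          rw [le_div_iff₀ (by positivity), mul_comm]; exact hlev i
        calc c i * (x i ⬝ᵥ y j) ^ 2 ≤ c i * ((x i ⬝ᵥ Q⁻¹ *ᵥ x i) * α) :=
              mul_le_mul_of_nonneg_left h1 (hc i).le
          _ = c i * (x i ⬝ᵥ Q⁻¹ *ᵥ x i) * α := by ring
          _ ≤ d / N * α := mul_le_mul_of_nonneg_right h2 hαpos.le
      have hsum : ∑ i, r i = g j ⬝ᵥ y j := by
        rw [hg, sum_dotProduct]
        refine Finset.sum_congr rfl fun i _ => ?_
        rw [smul_dotProduct, smul_eq_mul, hr]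
        ring
      have hβle : β ≤ √(d / N * α) * (g j ⬝ᵥ y j) := by
        rw [← hsum, Finset.mul_sum]
        refine Finset.sum_le_sum fun i _ => ?_
        rw [← hr2, sq]
        exact mul_le_mul_of_nonneg_right (hrle i) (hr0 i)
      have h1 : ((1 - δ) * α) ^ 2 ≤ d / N * α * ((g j ⬝ᵥ Q⁻¹ *ᵥ g j) * α) := by
        calc ((1 - δ) * α) ^ 2 ≤ (√(d / N * α) * (g j ⬝ᵥ y j)) ^ 2 :=
              pow_le_pow_left₀ (mul_nonneg (by linarith) hαpos.le) (hβα.trans hβle) 2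
          _ = d / N * α * (g j ⬝ᵥ y j) ^ 2 := by
              rw [mul_pow, Real.sq_sqrt (by positivity)]
          _ ≤ _ := mul_le_mul_of_nonneg_left (sq_dotProduct_le_of_posDef hQ _ _) (by positivity)
      have h2 : (1 - δ) ^ 2 ≤ d / N * (g j ⬝ᵥ Q⁻¹ *ᵥ g j) := by
        refine le_of_mul_le_mul_right ?_ (show 0 < α ^ 2 by positivity)
        linarith
      rw [div_mul_eq_mul_div, le_div_iff₀ (by positivity)] at h2
      exact h2
    have htotal : ∑ j, (g j ⬝ᵥ Q⁻¹ *ᵥ g j) ≤ N * d := by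
      have h1 : ∀ j, g j ⬝ᵥ Q⁻¹ *ᵥ g j = ∑ i, ∑ i', √(c i) * √(c i') * (x i' ⬝ᵥ Q⁻¹ *ᵥ x i) *
          (H i j * H i' j) := by
        intro j
        simp only [hg, Matrix.mulVec_sum, sum_dotProduct, dotProduct_sum, Matrix.mulVec_smul,
          smul_dotProduct, dotProduct_smul, smul_eq_mul, Finset.mul_sum]
        exact Finset.sum_congr rfl fun i _ => Finset.sum_congr rfl fun i' _ => by ring
      have h2 : ∀ i i', ∑ j, H i j * H i' j = if i = i' then (N : ℝ) else 0 := by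
        intro i i'
        have := congrFun (congrFun hH i) i'
        simpa [Matrix.mul_apply, Matrix.one_apply] using this
      calc ∑ j, (g j ⬝ᵥ Q⁻¹ *ᵥ g j)
          = ∑ i, ∑ i', √(c i) * √(c i') * (x i' ⬝ᵥ Q⁻¹ *ᵥ x i) * ∑ j, H i j * H i' j := by
            rw [Finset.sum_congr rfl fun j _ => h1 j, Finset.sum_comm]
            refine Finset.sum_congr rfl fun i _ => ?_
            rw [Finset.sum_comm]
            exact Finset.sum_congr rfl fun i' _ => (Finset.mul_sum _ _ _).symm
        _ = ∑ i, N * (c i * (x i ⬝ᵥ Q⁻¹ *ᵥ x i)) := by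
            refine Finset.sum_congr rfl fun i _ => ?_
            simp only [h2, mul_ite, mul_zero, Finset.sum_ite_eq, Finset.mem_univ, if_true,
              Real.mul_self_sqrt (hc i).le]
            ring
        _ ≤ ∑ _i : ι, (d : ℝ) := Finset.sum_le_sum fun i _ => hlev i
        _ = N * d := by simp [hN]
    have h3 : N * ((1 - δ) ^ 2 * N) ≤ d * (N * d) := by
      calc N * ((1 - δ) ^ 2 * N) = ∑ _j : ι, (1 - δ) ^ 2 * (N : ℝ) := by simp [hN]
        _ ≤ ∑ j, d * (g j ⬝ᵥ Q⁻¹ *ᵥ g j) := Finset.sum_le_sum fun j _ => hcol j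
        _ = d * ∑ j, (g j ⬝ᵥ Q⁻¹ *ᵥ g j) := (Finset.mul_sum _ _ _).symm
        _ ≤ _ := mul_le_mul_of_nonneg_left htotal (by positivity)
    have hN' : (0 : ℝ) < N := by positivity
    nlinarith
  by_contra! hlt
  have h1 : ((d ^ 2 + 1 : ℕ) : ℝ) ≤ N := by exact_mod_cast hlt
  push_cast at h1
  have hN' : (0 : ℝ) < N := by positivity
  have hδ : (1 : ℝ) / (2 * N + 1) * (2 * N + 1) = 1 := by field_simp
  have hδpos : (0 : ℝ) < 1 / (2 * N + 1) := by positivity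
  set δ : ℝ := 1 / (2 * N + 1)
  have h2 := key δ hδpos (by nlinarith)
  nlinarith [mul_pos hN' (pow_pos hδpos 2)]

theorem exists_hadamard (k : ℕ) : ∃ H : Matrix (Fin k → Bool) (Fin k → Bool) ℝ,
    H * Hᵀ = (Fintype.card (Fin k → Bool) : ℝ) • 1 ∧ ∀ a b, H a b = 1 ∨ H a b = -1 := by
  refine ⟨Matrix.of fun a b => ∏ i, if a i && b i then -1 else 1, ?_, fun a b => ?_⟩
  · ext a a'
    have h : ∀ s t : Bool, ∑ b : Bool,
        (if s && b then (-1 : ℝ) else 1) * (if t && b then -1 else 1) =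
          if s = t then 2 else 0 := by
      intro s t
      cases s <;> cases t <;> norm_num
    simp only [Matrix.mul_apply, Matrix.transpose_apply, Matrix.of_apply,
      ← Finset.prod_mul_distrib]
    rw [← Fintype.prod_sum fun i b =>
      (if a i && b then (-1 : ℝ) else 1) * (if a' i && b then -1 else 1)]
    simp only [h]
    by_cases haa : a = a'
    · subst haa
      simp
    · obtain ⟨i, hi⟩ := Function.ne_iff.1 haa
      rw [Finset.prod_eq_zero (Finset.mem_univ i) (by simp [hi])]
      simp [haa]
  · simp only [Matrix.of_apply]
    refine Finset.prod_induction _ (fun t : ℝ => t = 1 ∨ t = -1) ?_ (Or.inl rfl) ?_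
    · rintro s t (rfl | rfl) (rfl | rfl) <;> norm_num
    · intro i _
      split <;> simp

/-- A real matrix factors through its rank. -/
theorem exists_dotProduct_of_rank {ι κ : Type*} [Fintype ι] [Fintype κ]
    (D : Matrix ι κ ℝ) :
    ∃ (x : ι → Fin D.rank → ℝ) (y : κ → Fin D.rank → ℝ), ∀ i j, D i j = x i ⬝ᵥ y j := by
  classical
  let b : Module.Basis (Fin D.rank) ℝ (LinearMap.range D.mulVecLin) :=
    Module.finBasisOfFinrankEq ℝ _ rfl
  refine ⟨fun i l => (b l : ι → ℝ) i,
    fun j l => b.repr ⟨D.mulVecLin (Pi.single j 1), LinearMap.mem_range_self _ _⟩ l, fun i j => ?_⟩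
  have h := congrArg (fun v : LinearMap.range D.mulVecLin => (v : ι → ℝ) i)
    (b.sum_repr ⟨D.mulVecLin (Pi.single j 1), LinearMap.mem_range_self _ _⟩)
  simp only [Submodule.coe_sum, Submodule.coe_smul, Finset.sum_apply, Pi.smul_apply, smul_eq_mul,
    Matrix.mulVecLin_apply, Matrix.mulVec_single_one, Matrix.col_apply] at h
  rw [← h, dotProduct]
  refine Finset.sum_congr rfl fun l _ => ?_
  simp only [Matrix.mulVecLin_apply, Matrix.mulVec_single_one]
  exact mul_comm _ _

/-- Strategies come in pairs labelled by `ι`; the data set observes, inside each `2 × 2` block,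
the two diagonal profiles or the two off-diagonal ones, according to `S`. -/
def blockDataset {ι : Type*} {n : ℕ} (e : Fin n ≃ ι × Bool) (S : ι → ι → Bool) :
    Finset (Obs n) :=
  (Finset.univ.filter fun p : Fin n × Fin n =>
    ((e p.1).2 == (e p.2).2) = S (e p.1).1 (e p.2).1).image fun p =>
      (p, {p.1, e.symm ((e p.1).1, !(e p.1).2)}, {p.2, e.symm ((e p.2).1, !(e p.2).2)})

theorem isDataset_blockDataset {ι : Type*} {n : ℕ} (e : Fin n ≃ ι × Bool) (S : ι → ι → Bool) :
    IsDataset (blockDataset e S) := by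
  intro o ho
  obtain ⟨p, -, rfl⟩ := Finset.mem_image.1 ho
  simp

theorem rationalizable_blockDataset {ι : Type*} {n : ℕ} (e : Fin n ≃ ι × Bool)
    (S : ι → ι → Bool) : Rationalizable (blockDataset e S) := by
  let A : Matrix (Fin n) (Fin n) ℝ := Matrix.of fun i j =>
    if ((e i).2 == (e j).2) = S (e i).1 (e j).1 then 1 else 0
  refine ⟨A, A, fun o ho => ?_⟩
  obtain ⟨⟨i, j⟩, hp, rfl⟩ := Finset.mem_image.1 ho
  have hp' : ((e i).2 == (e j).2) = S (e i).1 (e j).1 := by simpa using hp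
  have h1 : A i j = 1 := by simp only [A, Matrix.of_apply, if_pos hp']
  refine ⟨by simp, by simp, fun i' hi' hne => ?_, fun j' hj' hne => ?_⟩
  · simp only [Finset.mem_insert, Finset.mem_singleton, hne, false_or] at hi'
    subst hi'
    rw [h1]
    simp only [A, Matrix.of_apply, Equiv.apply_symm_apply, ← hp']
    cases (e i).2 <;> cases (e j).2 <;> simp
  · simp only [Finset.mem_insert, Finset.mem_singleton, hne, false_or] at hj'
    subst hj'
    rw [h1]
    simp only [A, Matrix.of_apply, Equiv.apply_symm_apply, ← hp']
    cases (e i).2 <;> cases (e j).2 <;> simp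

/-- The alternating sums of a matrix over its `2 × 2` blocks. -/
def blockDifference {ι : Type*} {n : ℕ} (e : Fin n ≃ ι × Bool) (M : Matrix (Fin n) (Fin n) ℝ) :
    Matrix ι ι ℝ :=
  Matrix.of fun a b => M (e.symm (a, false)) (e.symm (b, false)) -
    M (e.symm (a, true)) (e.symm (b, false)) - M (e.symm (a, false)) (e.symm (b, true)) +
    M (e.symm (a, true)) (e.symm (b, true))

theorem rank_blockDifference_le {ι : Type*} [Fintype ι] {n : ℕ} (e : Fin n ≃ ι × Bool)
    (M : Matrix (Fin n) (Fin n) ℝ) : (blockDifference e M).rank ≤ M.rank := by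
  classical
  let P : Matrix ι (Fin n) ℝ := Matrix.of fun a i =>
    (if i = e.symm (a, false) then 1 else 0) - (if i = e.symm (a, true) then 1 else 0)
  have h : blockDifference e M = P * M * Pᵀ := by
    ext a b
    simp only [blockDifference, P, Matrix.mul_apply, Matrix.transpose_apply, Matrix.of_apply,
      sub_mul, mul_sub, Finset.sum_sub_distrib, ite_mul, mul_ite, one_mul, mul_one, zero_mul,
      mul_zero, Finset.sum_ite_eq', Finset.mem_univ, if_true]
    ring
  rw [h]
  exact (Matrix.rank_mul_le_left _ _).trans (Matrix.rank_mul_le_right _ _)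

theorem sign_blockDifference {ι : Type*} {n : ℕ} (e : Fin n ≃ ι × Bool) (S : ι → ι → Bool)
    {A B : Matrix (Fin n) (Fin n) ℝ} (h : Rationalizes A B (blockDataset e S)) (a b : ι) :
    0 < (if S a b then (1 : ℝ) else -1) * blockDifference e (A + B) a b := by
  have hobs : ∀ s t : Bool, (s == t) = S a b →
      A (e.symm (a, !s)) (e.symm (b, t)) < A (e.symm (a, s)) (e.symm (b, t)) ∧
      B (e.symm (a, s)) (e.symm (b, !t)) < B (e.symm (a, s)) (e.symm (b, t)) := by
    intro s t hst
    have hmem := h _ (Finset.mem_image_of_mem _ (Finset.mem_filter.2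
      ⟨Finset.mem_univ (e.symm (a, s), e.symm (b, t)), by simpa using hst⟩))
    exact ⟨hmem.2.2.1 _ (by simp) (by simp), hmem.2.2.2 _ (by simp) (by simp)⟩
  cases hS : S a b
  · have h1 := hobs false true (by simp [hS])
    have h2 := hobs true false (by simp [hS])
    simp only [Bool.not_false, Bool.not_true] at h1 h2
    simp only [blockDifference, Matrix.of_apply, Matrix.add_apply, Bool.false_eq_true, if_false]
    linarith
  · have h1 := hobs false false (by simp [hS])
    have h2 := hobs true true (by simp [hS])
    simp only [Bool.not_false, Bool.not_true] at h1 h2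
    simp only [blockDifference, Matrix.of_apply, Matrix.add_apply, if_true]
    linarith

/-- For every `k ≥ 1` and `n = 2^(k+1)`, there exists a rationalizable
data set `T` over an `n × n` strategy space such that every bimatrix game `(A,B)` that
rationalizes `T` satisfies `rank (A+B) ≥ √(n/2)`. -/
theorem high_rank_datasets_exist (k n : ℕ) (hk : 1 ≤ k) (hn : n = 2 ^ (k + 1)) :
    ∃ T : Finset (Obs n), IsDataset T ∧ Rationalizable T ∧
      ∀ A B : Matrix (Fin n) (Fin n) ℝ, Rationalizes A B T →
        Real.sqrt ((n : ℝ) / 2) ≤ ((A + B).rank : ℝ) := by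
  classical
  obtain ⟨H, hH, hsign⟩ := exists_hadamard k
  have hcard : Fintype.card (Fin k → Bool) = 2 ^ k := by simp
  have e : Fin n ≃ (Fin k → Bool) × Bool :=
    Fintype.equivOfCardEq (by rw [Fintype.card_prod, hcard]; simp [hn, pow_succ])
  set S : (Fin k → Bool) → (Fin k → Bool) → Bool := fun a b => decide (H a b = 1) with hS
  refine ⟨blockDataset e S, isDataset_blockDataset e S, rationalizable_blockDataset e S,
    fun A B hAB => ?_⟩
  obtain ⟨x, y, hxy⟩ := exists_dotProduct_of_rank (blockDifference e (A + B))
  have hHS : ∀ a b, H a b = if S a b then 1 else -1 := by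
    intro a b
    rcases hsign a b with h | h <;> norm_num [hS, h]
  have hle := card_le_sq_of_sign_factorization H hH
    (fun a b => by rcases hsign a b with h | h <;> simp [h]) x y
    (fun a b => by rw [← hxy, hHS]; exact sign_blockDifference e S hAB a b)
  rw [hcard, Fintype.card_fin] at hle
  have hle' : 2 ^ k ≤ (A + B).rank ^ 2 :=
    hle.trans (Nat.pow_le_pow_left (rank_blockDifference_le e (A + B)) 2)
  refine Real.sqrt_le_iff.2 ⟨Nat.cast_nonneg _, ?_⟩
  have hhalf : (n : ℝ) / 2 = ((2 ^ k : ℕ) : ℝ) := by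
    rw [hn]; push_cast; ring
  rw [hhalf]
  exact_mod_cast hle'
end

section
/- For every integer k ≥ 1, set n = 2^{k+1}. There exists a rationalizable data set T over an n × n strategy space that satisfies the uniqueness property and such that every bimatrix game (A,B) that rationalizes T satisfies rank(A+B) ≥ √(n/2). -/
/-- The uniqueness property: every subgame appearing in `T` has exactly one observed choice,
and whenever `((i,j),I,J), ((i',j'),I',J') ∈ T` with `I'×J' ⊆ I×J` and `(i,j) ∈ I'×J'`,
then `(i',j') = (i,j)`. -/
def UniqueProp {n : ℕ} (T : Finset (Obs n)) : Prop :=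
  (∀ o ∈ T, ∀ o' ∈ T, o.2 = o'.2 → o.1 = o'.1) ∧
  (∀ o ∈ T, ∀ o' ∈ T, o'.2.1 ×ˢ o'.2.2 ⊆ o.2.1 ×ˢ o.2.2 →
      o.1 ∈ o'.2.1 ×ˢ o'.2.2 → o'.1 = o.1)

open Matrix

/-- Determinant of a rank-one update of a positive definite matrix. -/
lemma det_add_smul_vecMulVec {κ : Type*} [Fintype κ] [DecidableEq κ] {S : Matrix κ κ ℝ}
    (hS : S.PosDef) (c : ℝ) (u : κ → ℝ) :
    (S + c • vecMulVec u u).det = S.det * (1 + c * (u ⬝ᵥ S⁻¹ *ᵥ u)) := by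
  have h : c • vecMulVec u u = replicateCol Unit (c • u) * replicateRow Unit u := by
    rw [← smul_vecMulVec, vecMulVec_eq Unit]
  rw [h, det_add_replicateCol_mul_replicateRow hS.det_pos.ne'.isUnit]
  congr 1
  rw [det_unique, Matrix.add_apply, one_apply_eq, ← replicateRow_vecMul,
    replicateRow_mul_replicateCol_apply, ← dotProduct_mulVec,
    mulVec_smul, dotProduct_smul, smul_eq_mul]

lemma posSemidef_smul_vecMulVec {κ : Type*} [Fintype κ] {c : ℝ} (hc : 0 ≤ c) (u : κ → ℝ) :
    (c • vecMulVec u u).PosSemidef := by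
  simpa using (posSemidef_vecMulVec_self_star u).smul hc

lemma posDef_and_det_le_det_add_sum {ι κ : Type*} [Fintype κ] [DecidableEq κ] [DecidableEq ι]
    {S : Matrix κ κ ℝ} (hS : S.PosDef) (x : ι → κ → ℝ) {w : ι → ℝ} (hw : ∀ i, 0 ≤ w i)
    (s : Finset ι) :
    (S + ∑ i ∈ s, w i • vecMulVec (x i) (x i)).PosDef ∧
      S.det ≤ (S + ∑ i ∈ s, w i • vecMulVec (x i) (x i)).det := by
  induction s using Finset.induction_on with
  | empty => simpa using hS
  | insert i s hi ih =>
    obtain ⟨hP, hle⟩ := ih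
    rw [Finset.sum_insert hi, add_comm (w i • _), ← add_assoc]
    refine ⟨hP.add_posSemidef (posSemidef_smul_vecMulVec (hw i) _), ?_⟩
    rw [det_add_smul_vecMulVec hP]
    refine hle.trans (le_mul_of_one_le_right hP.det_pos.le ?_)
    have := hP.inv.posSemidef.dotProduct_mulVec_nonneg (x i)
    simp only [star_trivial] at this
    nlinarith [mul_nonneg (hw i) this]

/-- The weighted Gram (frame) matrix `∑ i, w i • x i (x i)ᵀ`. -/
def frameMatrix {ι κ : Type*} [Fintype ι] (x : ι → κ → ℝ) (w : ι → ℝ) : Matrix κ κ ℝ :=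
  ∑ i, w i • vecMulVec (x i) (x i)

lemma exists_pos_mul_prod_le_det_frameMatrix {ι : Type*} [Fintype ι] [DecidableEq ι] {r : ℕ}
    (x : ι → Fin r → ℝ)
    (gp : ∀ e : Fin r ↪ ι, (Matrix.of fun a => x (e a)).det ≠ 0) :
    ∃ δ > 0, ∀ w : ι → ℝ, (∀ i, 0 < w i) → ∀ I : Finset ι, I.card = r →
      (frameMatrix x w).PosDef ∧ δ * ∏ i ∈ I, w i ≤ (frameMatrix x w).det := by
  obtain ⟨δ, hδ, hle⟩ : ∃ δ > 0, ∀ e : Fin r ↪ ι,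
      δ ≤ (Matrix.of fun a => x (e a)).det ^ 2 := by
    cases isEmpty_or_nonempty (Fin r ↪ ι) with
    | inl h => exact ⟨1, one_pos, fun e => h.elim e⟩
    | inr h =>
      obtain ⟨e, he⟩ := Finite.exists_min fun e : Fin r ↪ ι =>
        (Matrix.of fun a => x (e a)).det ^ 2
      exact ⟨_, by have := gp e; positivity, he⟩
  refine ⟨δ, hδ, fun w hw I hI => ?_⟩
  let e : Fin r ↪ ι := ⟨fun a => (I.equivFinOfCardEq hI).symm a,
    fun a b h => by simpa using Subtype.ext h⟩
  have hmap : Finset.univ.map e = I := by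
    ext i
    simp only [Finset.mem_map, Finset.mem_univ, true_and]
    refine ⟨?_, fun hi => ⟨I.equivFinOfCardEq hI ⟨i, hi⟩, ?_⟩⟩
    · rintro ⟨a, rfl⟩
      exact ((I.equivFinOfCardEq hI).symm a).2
    · change ((I.equivFinOfCardEq hI).symm _ : ι) = i
      simp
  set X : Matrix (Fin r) (Fin r) ℝ := Matrix.of fun a => x (e a) with hX
  have hS : ∑ i ∈ I, w i • vecMulVec (x i) (x i) =
      Xᴴ * diagonal (fun a => w (e a)) * X := by
    rw [← hmap, Finset.sum_map]
    ext a b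
    simp [Matrix.sum_apply, mul_apply, vecMulVec_apply, diagonal_apply, hX]
    exact Finset.sum_congr rfl fun c _ => by ring
  have hXu : IsUnit X := (isUnit_iff_isUnit_det _).2 (gp e).isUnit
  have hP : (∑ i ∈ I, w i • vecMulVec (x i) (x i)).PosDef := by
    rw [hS]
    exact (PosDef.diagonal fun a => hw _).conjTranspose_mul_mul_same
      (mulVec_injective_of_isUnit hXu)
  have hsplit : frameMatrix x w = ∑ i ∈ I, w i • vecMulVec (x i) (x i) +
      ∑ i ∈ Iᶜ, w i • vecMulVec (x i) (x i) := (Finset.sum_add_sum_compl _ _).symm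
  have hdet : (∑ i ∈ I, w i • vecMulVec (x i) (x i)).det = X.det ^ 2 * ∏ i ∈ I, w i := by
    rw [hS, det_mul, det_mul, det_conjTranspose, det_diagonal, ← hmap, Finset.prod_map]
    simp only [star_trivial]
    ring
  have := posDef_and_det_le_det_add_sum hP x (fun i => (hw i).le) Iᶜ
  rw [← hsplit, hdet] at this
  exact ⟨this.1, (mul_le_mul_of_nonneg_right (hle e)
    (Finset.prod_nonneg fun i _ => (hw i).le)).trans this.2⟩

lemma Finset.exists_subset_card_eq_average_le {ι : Type*} [DecidableEq ι] (t : ι → ℝ) {p : ℕ}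
    (s : Finset ι) (hp : p ≤ s.card) :
    ∃ J ⊆ s, J.card = p ∧ p * ∑ i ∈ s, t i ≤ s.card * ∑ i ∈ J, t i := by
  induction s using Finset.strongInduction with
  | H s ih =>
    rcases hp.eq_or_lt with h | h
    · exact ⟨s, Finset.Subset.refl s, h.symm, by rw [h]⟩
    · have hne : s.Nonempty := Finset.card_pos.1 (by omega)
      obtain ⟨a, ha, hmin⟩ := s.exists_min_image t hne
      have hc := Finset.card_erase_add_one ha
      obtain ⟨J, hJ, hJc, hle⟩ := ih (s.erase a) (Finset.erase_ssubset ha) (by omega)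
      refine ⟨J, hJ.trans (Finset.erase_subset _ _), hJc, ?_⟩
      have hsum := Finset.add_sum_erase s t ha
      have hJa : J.card • t a ≤ ∑ i ∈ J, t i :=
        Finset.card_nsmul_le_sum _ _ _ fun i hi => hmin i (Finset.erase_subset _ _ (hJ hi))
      rw [hJc, nsmul_eq_mul] at hJa
      rw [← hsum, ← hc]
      push_cast
      linarith

lemma continuous_frameMatrix {ι κ : Type*} [Fintype ι] (x : ι → κ → ℝ) :
    Continuous (frameMatrix x) :=
  continuous_finsetSum _ fun i _ => (continuous_apply i).smul continuous_const

lemma frameMatrix_smul {ι κ : Type*} [Fintype ι] (x : ι → κ → ℝ) (c : ℝ) (w : ι → ℝ) :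
    frameMatrix x (c • w) = c • frameMatrix x w := by
  simp [frameMatrix, Finset.smul_sum, smul_smul]

lemma frameMatrix_add_single {ι κ : Type*} [Fintype ι] [DecidableEq ι] (x : ι → κ → ℝ)
    (w : ι → ℝ) (i : ι) (c : ℝ) :
    frameMatrix x (w + Pi.single i c) = frameMatrix x w + c • vecMulVec (x i) (x i) := by
  simp only [frameMatrix, Pi.add_apply, add_smul, Finset.sum_add_distrib]
  congr 1
  rw [Finset.sum_eq_single i] <;> simp +contextual

/-- Vectors in general position admit weights putting them in radial isotropic position. -/
theorem exists_radial_isotropic {ι : Type*} [Fintype ι] [DecidableEq ι] {r : ℕ}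
    (hr : 0 < r) (hrm : r < Fintype.card ι) (x : ι → Fin r → ℝ)
    (gp : ∀ e : Fin r ↪ ι, (Matrix.of fun a => x (e a)).det ≠ 0) :
    ∃ w : ι → ℝ, (∀ i, 0 < w i) ∧ (frameMatrix x w).PosDef ∧
      ∀ i, w i * (x i ⬝ᵥ (frameMatrix x w)⁻¹ *ᵥ x i) = r / Fintype.card ι := by
  set m := Fintype.card ι with hm
  obtain ⟨δ, hδ, hlow⟩ := exists_pos_mul_prod_le_det_frameMatrix x gp
  obtain ⟨I₀, hI₀⟩ : ∃ I : Finset ι, I.card = r := by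
    obtain ⟨I, -, hI⟩ := Finset.exists_subset_card_eq (s := (Finset.univ : Finset ι)) hrm.le
    exact ⟨I, hI⟩
  have hpd : ∀ w : ι → ℝ, (∀ i, 0 < w i) → (frameMatrix x w).PosDef :=
    fun w hw => (hlow w hw I₀ hI₀).1
  set E : (ι → ℝ) → ι → ℝ := fun t i => Real.exp (t i) with hE
  have hEpos : ∀ t i, 0 < E t i := fun t i => Real.exp_pos _
  set G : (ι → ℝ) → ℝ := fun t => Real.log (frameMatrix x (E t)).det with hG
  have hEcont : Continuous E := by fun_prop
  have hGcont : Continuous G :=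
    (((continuous_frameMatrix x).comp hEcont).matrix_det).log
      fun t => (hpd _ (hEpos t)).det_pos.ne'
  have hGlow : ∀ t (I : Finset ι), I.card = r → Real.log δ + ∑ i ∈ I, t i ≤ G t := by
    intro t I hI
    have h1 : ∏ i ∈ I, E t i = Real.exp (∑ i ∈ I, t i) := (Real.exp_sum _ _).symm
    have h2 := (hlow _ (hEpos t) I hI).2
    rw [h1] at h2
    have h3 := Real.log_le_log (by positivity) h2
    rwa [Real.log_mul hδ.ne' (Real.exp_ne_zero _), Real.log_exp] at h3
  set L := G 0 - Real.log δ with hL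
  have hL0 : 0 ≤ L := by simpa [hL] using hGlow 0 I₀ hI₀
  have hup : ∀ t : ι → ℝ, ∑ i, t i = 0 → G t ≤ G 0 → ∀ i, t i ≤ m * L := by
    intro t ht htG i
    obtain ⟨J, hJ, hJc, hJle⟩ := Finset.exists_subset_card_eq_average_le t (p := r - 1)
      (Finset.univ.erase i) (by rw [Finset.card_erase_of_mem (Finset.mem_univ i)]; simp; omega)
    have hiJ : i ∉ J := fun h => Finset.notMem_erase i _ (hJ h)
    have h1 := hGlow t (insert i J) (by rw [Finset.card_insert_of_notMem hiJ]; omega)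
    rw [Finset.sum_insert hiJ] at h1
    have h2 := Finset.add_sum_erase Finset.univ t (Finset.mem_univ i)
    rw [ht] at h2
    rw [Finset.card_erase_of_mem (Finset.mem_univ i), Finset.card_univ,
      Nat.cast_sub (by omega), Nat.cast_sub (by omega), eq_neg_of_add_eq_zero_right h2] at hJle
    push_cast at hJle
    have hrm' : (r : ℝ) + 1 ≤ m := by exact_mod_cast hrm
    have hm1 : (0 : ℝ) ≤ m - 1 := by
      have : (0 : ℝ) ≤ r := by positivity
      linarith
    have h3 : t i + ∑ j ∈ J, t j ≤ L := by linarith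
    have h4 := mul_le_mul_of_nonneg_left h3 hm1
    by_contra! hcon
    have h5 : 0 ≤ t i := le_trans (by positivity) hcon.le
    nlinarith [mul_nonneg h5 (sub_nonneg.2 hrm')]
  have hlo : ∀ t : ι → ℝ, ∑ i, t i = 0 → G t ≤ G 0 → ∀ i, -(m * (m * L)) ≤ t i := by
    intro t ht htG i
    have h2 := Finset.add_sum_erase Finset.univ t (Finset.mem_univ i)
    have h3 := Finset.sum_le_card_nsmul (Finset.univ.erase i) t (m * L)
      fun j _ => hup t ht htG j
    have h4 : ((Finset.univ.erase i).card : ℝ) ≤ m := by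
      exact_mod_cast Finset.card_le_univ _
    rw [nsmul_eq_mul] at h3
    have := mul_le_mul_of_nonneg_right h4 (by positivity : 0 ≤ m * L)
    linarith
  set K : Set (ι → ℝ) := {t | ∑ i, t i = 0 ∧ G t ≤ G 0} with hK
  have hKc : IsCompact K := by
    refine IsCompact.of_isClosed_subset
      (isCompact_Icc (a := fun _ : ι => -(m * (m * L))) (b := fun _ => m * L)) ?_ ?_
    · exact (isClosed_eq (by fun_prop) continuous_const).inter
        (isClosed_le hGcont continuous_const)
    · exact fun t ht => ⟨fun i => hlo t ht.1 ht.2 i, fun i => hup t ht.1 ht.2 i⟩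
  obtain ⟨t, htK, hmin⟩ := hKc.exists_isMinOn ⟨0, by simp [hK]⟩ hGcont.continuousOn
  have hm0 : (0 : ℝ) < m := by exact_mod_cast hr.trans hrm
  have hglob : ∀ t' : ι → ℝ, G t ≤ G t' - r / m * ∑ i, t' i := by
    intro t'
    set c := (∑ i, t' i) / m with hc
    have hshift : G (fun i => t' i - c) = G t' - r * c := by
      have : E (fun i => t' i - c) = Real.exp (-c) • E t' := by
        ext i
        simp [hE, ← Real.exp_add]
        ring
      simp only [hG, this, frameMatrix_smul, det_smul, Fintype.card_fin]
      rw [Real.log_mul (by positivity) (hpd _ (hEpos t')).det_pos.ne', Real.log_pow, Real.log_exp]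
      ring
    have hsum : ∑ i, (t' i - c) = 0 := by
      rw [Finset.sum_sub_distrib, Finset.sum_const, Finset.card_univ, nsmul_eq_mul, ← hm, hc]
      field_simp
      ring
    have : G t ≤ G (fun i => t' i - c) := by
      by_cases h : G (fun i => t' i - c) ≤ G 0
      · exact hmin ⟨hsum, h⟩
      · exact htK.2.trans (not_le.1 h).le
    rw [hshift, hc] at this
    convert this using 2
    ring
  have hPD := hpd _ (hEpos t)
  refine ⟨E t, hEpos t, hPD, fun i => ?_⟩
  set q := E t i * (x i ⬝ᵥ (frameMatrix x (E t))⁻¹ *ᵥ x i) with hq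
  have hvar : ∀ u : ℝ, G (t + Pi.single i u) = G t + Real.log (1 + (Real.exp u - 1) * q) := by
    intro u
    have h1 : E (t + Pi.single i u) = E t + Pi.single i (E t i * (Real.exp u - 1)) := by
      ext j
      rcases eq_or_ne j i with rfl | h
      · simp [hE, Real.exp_add]
        ring
      · simp [hE, h]
    have h2 := (hpd _ (hEpos (t + Pi.single i u))).det_pos
    have h3 : (frameMatrix x (E (t + Pi.single i u))).det =
        (frameMatrix x (E t)).det * (1 + (Real.exp u - 1) * q) := by
      rw [h1, frameMatrix_add_single, det_add_smul_vecMulVec hPD, hq]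
      ring
    simp only [hG]
    rw [h3] at h2 ⊢
    exact Real.log_mul hPD.det_pos.ne' (pos_of_mul_pos_right h2 hPD.det_pos.le).ne'
  set φ : ℝ → ℝ := fun u => Real.log (1 + (Real.exp u - 1) * q) - r / m * u with hφ
  have hφmin : IsLocalMin φ 0 := by
    refine Filter.Eventually.of_forall fun u => ?_
    have h1 := hglob (t + Pi.single i u)
    rw [hvar] at h1
    simp only [Pi.add_apply, Finset.sum_add_distrib, htK.1, Finset.sum_pi_single',
      Finset.mem_univ, if_true, zero_add] at h1
    simp only [hφ]
    simp
    linarith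
  have hderiv : HasDerivAt φ (q - r / m) 0 := by
    have h1 : HasDerivAt (fun u : ℝ => 1 + (Real.exp u - 1) * q) q 0 := by
      simpa using (((Real.hasDerivAt_exp 0).sub_const 1).mul_const q).const_add 1
    have h2 := h1.log (by simp)
    exact (h2.sub ((hasDerivAt_id (0 : ℝ)).const_mul ((r : ℝ) / m))).congr_deriv (by simp)
  linarith [hφmin.hasDerivAt_eq_zero hderiv]

lemma dotProduct_sq_le_of_posDef {κ : Type*} [Fintype κ] [DecidableEq κ] {S : Matrix κ κ ℝ}
    (hS : S.PosDef) (v y : κ → ℝ) :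
    (v ⬝ᵥ y) ^ 2 ≤ (v ⬝ᵥ S⁻¹ *ᵥ v) * (y ⬝ᵥ S *ᵥ y) := by
  set p := S⁻¹ *ᵥ v with hp
  have hSp : S *ᵥ p = v := by
    rw [hp, mulVec_mulVec, mul_nonsing_inv _ hS.det_pos.ne'.isUnit, one_mulVec]
  have hsymm : p ⬝ᵥ S *ᵥ y = v ⬝ᵥ y := by
    have hT : Sᵀ = S := by simpa using hS.isHermitian.eq
    rw [dotProduct_mulVec, ← mulVec_transpose, hT, hSp]
  have hq : ∀ t : ℝ, 0 ≤ (v ⬝ᵥ p) * (t * t) + (-2 * (v ⬝ᵥ y)) * t + y ⬝ᵥ S *ᵥ y := by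
    intro t
    have h := hS.posSemidef.dotProduct_mulVec_nonneg (t • p - y)
    simp only [star_trivial, mulVec_sub, mulVec_smul, hSp, sub_dotProduct, dotProduct_sub,
      smul_dotProduct, dotProduct_smul, hsymm, smul_eq_mul] at h
    rw [dotProduct_comm p v, dotProduct_comm y v] at h
    linarith
  have := discrim_le_zero hq
  simp only [discrim] at this
  linarith

open Topology Filter in
/-- Matrices all of whose maximal minors are nonzero are dense. -/
lemma exists_mem_forall_minor_ne_zero {ι : Type*} [Fintype ι] {r : ℕ}
    {U : Set (Matrix ι (Fin r) ℝ)} (hU : IsOpen U) {X : Matrix ι (Fin r) ℝ} (hX : X ∈ U) :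
    ∃ X' ∈ U, ∀ e : Fin r ↪ ι, (Matrix.of fun a => X' (e a)).det ≠ 0 := by
  classical
  let v : ι → ℝ := fun i => ((Fintype.equivFin ι i : ℕ) : ℝ)
  have hv : Function.Injective v := fun i j h => by
    simpa [v, Fin.val_inj] using h
  let V : Matrix ι (Fin r) ℝ := Matrix.of fun i a => v i ^ (a : ℕ)
  have h1 : ∀ᶠ ε in 𝓝[≠] (0 : ℝ), X + ε • V ∈ U := by
    refine nhdsWithin_le_nhds ?_
    have hc : Continuous fun ε : ℝ => X + ε • V := by fun_prop
    exact hc.continuousAt.eventually (hU.mem_nhds (by simpa using hX))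
  have h2 : ∀ᶠ ε in 𝓝[≠] (0 : ℝ), ∀ e : Fin r ↪ ι,
      (Matrix.of fun a => (X + ε • V) (e a)).det ≠ 0 := by
    refine eventually_all.2 fun e => ?_
    let p : Polynomial ℝ := ((Polynomial.X : Polynomial ℝ) •
      (V.submatrix e id).map Polynomial.C + (X.submatrix e id).map Polynomial.C).det
    have hp : p ≠ 0 := by
      intro h0
      have h3 := Polynomial.coeff_det_X_add_C_card (V.submatrix e id) (X.submatrix e id)
      change p.coeff _ = _ at h3
      rw [h0, Polynomial.coeff_zero] at h3
      have h4 : V.submatrix e id = vandermonde (v ∘ e) := rfl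
      rw [h4] at h3
      exact det_vandermonde_ne_zero_iff.2 (hv.comp e.injective) h3.symm
    have heval : ∀ ε, p.eval ε = (Matrix.of fun a => (X + ε • V) (e a)).det := by
      intro ε
      change Polynomial.evalRingHom ε _ = _
      rw [RingHom.map_det]
      congr 1
      ext a b
      simp
      ring
    have h5 : ∀ᶠ ε in 𝓝[≠] (0 : ℝ), ε ∉ {ε | p.IsRoot ε} :=
      nhdsNE_le_cofinite 0 (Polynomial.finite_setOfPred_isRoot hp).eventually_cofinite_notMem
    exact h5.mono fun ε h => by rw [← heval]; exact h
  obtain ⟨ε, hε⟩ := (h1.and h2).exists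
  exact ⟨_, hε.1, hε.2⟩

lemma exists_eq_mul_of_rank {ι κ : Type*} [Fintype ι] [Fintype κ] (D : Matrix ι κ ℝ) :
    ∃ (X : Matrix ι (Fin D.rank) ℝ) (Y : Matrix (Fin D.rank) κ ℝ), D = X * Y := by
  let W := Submodule.span ℝ (Set.range D.col)
  let b := Module.finBasisOfFinrankEq ℝ W D.rank_eq_finrank_span_cols.symm
  let c : κ → W := fun j => ⟨D.col j, Submodule.subset_span ⟨j, rfl⟩⟩
  refine ⟨Matrix.of fun i a => (b a : ι → ℝ) i, Matrix.of fun a j => b.repr (c j) a, ?_⟩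
  ext i j
  have h := congrArg (fun u : W => (u : ι → ℝ) i) (b.sum_repr (c j))
  simp only [Submodule.coe_sum, Submodule.coe_smul, Finset.sum_apply, Pi.smul_apply,
    smul_eq_mul] at h
  simp only [mul_apply, of_apply]
  rw [← show D.col j i = D i j from rfl]
  exact h.symm.trans (Finset.sum_congr rfl fun a _ => mul_comm _ _)

lemma card_le_sq_of_minors_ne_zero {ι : Type*} [Fintype ι] [DecidableEq ι] {r : ℕ}
    (hr : 0 < r) (hrm : r < Fintype.card ι) {H : Matrix ι ι ℝ} (hH : H.IsHadamard)
    (X : Matrix ι (Fin r) ℝ) (Y : Matrix (Fin r) ι ℝ)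
    (gp : ∀ e : Fin r ↪ ι, (Matrix.of fun a => X (e a)).det ≠ 0)
    (hsign : ∀ i j, 0 < H i j * (X * Y) i j) : Fintype.card ι ≤ r ^ 2 := by
  have habs : ∀ i j, |H i j| = 1 := fun i j => by
    have := (hH.apply_mem i j).1
    simp only [star_trivial] at this
    rcases mul_self_eq_one_iff.1 this with h | h <;> simp [h]
  have hHH : H * Hᵀ = (Fintype.card ι : ℝ) • (1 : Matrix ι ι ℝ) := by
    simpa using hH.mul_conjTranspose
  set m := Fintype.card ι
  have hm0 : (0 : ℝ) < m := by exact_mod_cast hr.trans hrm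
  have hr0 : (0 : ℝ) < r := by exact_mod_cast hr
  obtain ⟨w, hw, hS, hwq⟩ := exists_radial_isotropic hr hrm X gp
  set S := frameMatrix X w
  set Z : Matrix ι (Fin r) ℝ := Matrix.of fun i a => √(w i) * X i a with hZ
  have hZS : Zᵀ * Z = S := by
    ext a b
    simp only [S, frameMatrix, mul_apply, transpose_apply, hZ, of_apply, Matrix.sum_apply,
      Matrix.smul_apply, vecMulVec_apply, smul_eq_mul]
    refine Finset.sum_congr rfl fun i _ => ?_
    rw [← Real.mul_self_sqrt (hw i).le, Real.sqrt_mul_self (Real.sqrt_nonneg _)]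
    ring
  have hrow : ∀ i, Z i = √(w i) • X i := fun i => rfl
  have hZq : ∀ i, Z i ⬝ᵥ S⁻¹ *ᵥ Z i = r / m := fun i => by
    rw [hrow, mulVec_smul, dotProduct_smul, smul_dotProduct, ← hwq i, smul_eq_mul, smul_eq_mul,
      ← mul_assoc, Real.mul_self_sqrt (hw i).le]
  set V := Hᵀ * Z with hV
  have hquad : ∀ (A : Matrix ι (Fin r) ℝ) i, (A * S⁻¹ * Aᵀ) i i = A i ⬝ᵥ S⁻¹ *ᵥ A i := by
    intro A i
    rw [Matrix.mul_assoc, mul_apply]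
    rfl
  have htrace : ∑ j, V j ⬝ᵥ S⁻¹ *ᵥ V j = m * r := by
    calc ∑ j, V j ⬝ᵥ S⁻¹ *ᵥ V j = (V * S⁻¹ * Vᵀ).trace := by
          simp only [trace, diag_apply, hquad]
      _ = ((Z * S⁻¹ * Zᵀ) * (H * Hᵀ)).trace := by
          rw [hV, transpose_mul, transpose_transpose, Matrix.trace_mul_comm (Z * S⁻¹ * Zᵀ),
            Matrix.mul_assoc H, Matrix.trace_mul_comm H]
          simp only [Matrix.mul_assoc]
      _ = m * r := by
          rw [hHH]
          rw [Matrix.mul_smul, Matrix.mul_one, Matrix.trace_smul]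
          simp only [trace, diag_apply, hquad, hZq, Finset.sum_const, Finset.card_univ,
            nsmul_eq_mul, smul_eq_mul]
          rw [mul_div_cancel₀ _ hm0.ne']
  have hcol : ∀ j, (m : ℝ) / r ≤ V j ⬝ᵥ S⁻¹ *ᵥ V j := by
    intro j
    set y : Fin r → ℝ := fun a => Y a j with hy
    set b : ι → ℝ := fun i => Z i ⬝ᵥ y with hb
    set c := y ⬝ᵥ S *ᵥ y with hc
    have hbX : ∀ i, b i = √(w i) * (X * Y) i j := fun i => by
      simp only [hb, hrow, smul_dotProduct, smul_eq_mul]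
      rfl
    have hHb : ∀ i, H i j * b i = |b i| := fun i => by
      have h : 0 ≤ H i j * b i := by
        rw [hbX, mul_left_comm]
        exact mul_nonneg (Real.sqrt_nonneg _) (hsign i j).le
      rw [← abs_of_nonneg h, abs_mul, habs, one_mul]
    have hcb : c = ∑ i, b i ^ 2 := by
      rw [hc, ← hZS, ← mulVec_mulVec, dotProduct_mulVec, vecMul_transpose]
      simp only [dotProduct, mulVec, hb, sq]
    have hVb : V j ⬝ᵥ y = ∑ i, |b i| := by
      have : V j ⬝ᵥ y = (Hᵀ *ᵥ (Z *ᵥ y)) j := by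
        rw [mulVec_mulVec]
        rfl
      rw [this]
      exact Finset.sum_congr rfl fun i _ => hHb i
    have hcpos : 0 < c := by
      have hy0 : y ≠ 0 := by
        intro h0
        have := hsign j j
        have hz : (X * Y) j j = X j ⬝ᵥ y := rfl
        simp [hz, h0] at this
      simpa using hS.dotProduct_mulVec_pos hy0
    set β := √(r / m * c)
    have hβ : ∀ i, |b i| ≤ β := fun i => by
      refine Real.abs_le_sqrt ?_
      rw [← hZq i]
      exact dotProduct_sq_le_of_posDef hS _ _
    have hlow : c ≤ β * ∑ i, |b i| := by
      rw [hcb, Finset.mul_sum]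
      refine Finset.sum_le_sum fun i _ => ?_
      rw [← sq_abs, sq]
      exact mul_le_mul_of_nonneg_right (hβ i) (abs_nonneg _)
    have hsq : c ^ 2 ≤ r / m * c * (∑ i, |b i|) ^ 2 := by
      have := pow_le_pow_left₀ hcpos.le hlow 2
      rwa [mul_pow, Real.sq_sqrt (by positivity)] at this
    have hcs := dotProduct_sq_le_of_posDef hS (V j) y
    rw [hVb] at hcs
    have h6 : c ^ 2 ≤ r / m * c * ((V j ⬝ᵥ S⁻¹ *ᵥ V j) * c) :=
      hsq.trans (mul_le_mul_of_nonneg_left hcs (by positivity))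
    have h7 : 1 ≤ r / m * (V j ⬝ᵥ S⁻¹ *ᵥ V j) := by
      refine le_of_mul_le_mul_right ?_ (by positivity : 0 < c ^ 2)
      linarith
    rw [div_le_iff₀ hr0]
    rw [div_mul_eq_mul_div, le_div_iff₀ hm0] at h7
    linarith
  have hsum := Finset.sum_le_sum fun j (_ : j ∈ Finset.univ) => hcol j
  rw [htrace, Finset.sum_const, Finset.card_univ, nsmul_eq_mul, mul_div_assoc', div_le_iff₀ hr0,
    mul_assoc] at hsum
  have h8 := le_of_mul_le_mul_left hsum hm0
  rw [← sq] at h8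
  exact_mod_cast h8

/-- **Forster's theorem** for Hadamard matrices: a real matrix with the sign pattern of a
Hadamard matrix of order `m` has rank at least `√m`. -/
theorem card_le_rank_sq_of_isHadamard {ι : Type*} [Fintype ι] [DecidableEq ι]
    {H : Matrix ι ι ℝ} (hH : H.IsHadamard) (D : Matrix ι ι ℝ)
    (hsign : ∀ i j, 0 < H i j * D i j) : Fintype.card ι ≤ D.rank ^ 2 := by
  obtain ⟨X, Y, hD⟩ := exists_eq_mul_of_rank D
  rcases le_or_gt (Fintype.card ι) D.rank with hle | hlt
  · exact hle.trans (Nat.le_self_pow two_ne_zero _)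
  rcases Nat.eq_zero_or_pos D.rank with h0 | hr
  · have : IsEmpty ι := ⟨fun i => by
      have hDi : D i i = 0 := by
        refine (congrFun₂ hD i i).trans ?_
        rw [mul_apply]
        exact Finset.sum_eq_zero fun a _ => absurd a.2 (by omega)
      have := hsign i i
      simp [hDi] at this⟩
    simp
  have hU : IsOpen {X : Matrix ι (Fin D.rank) ℝ | ∀ i j, 0 < H i j * (X * Y) i j} := by
    simp only [Set.ofPred_forall]
    refine isOpen_iInter_of_finite fun i => isOpen_iInter_of_finite fun j => ?_
    refine isOpen_lt continuous_const (continuous_const.mul ?_)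
    exact (continuous_id.matrix_mul continuous_const).matrix_elem i j
  obtain ⟨X', hX', gp⟩ := exists_mem_forall_minor_ne_zero hU (X := X) (by
    intro i j
    rw [← hD]
    exact hsign i j)
  exact card_le_sq_of_minors_ne_zero hr hlt hH X' Y gp hX'

lemma exists_isHadamard_two_pow (k : ℕ) :
    ∃ H : Matrix (Fin (2 ^ k)) (Fin (2 ^ k)) ℝ, H.IsHadamard := by
  induction k with
  | zero =>
    have h : (1 : Matrix (Fin 1) (Fin 1) ℝ).IsHadamard :=
      ⟨fun i j => by rw [Subsingleton.elim i j, one_apply_eq]; exact one_mem _, by simp, by simp⟩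
    exact ⟨_, h⟩
  | succ k ih =>
    obtain ⟨H, hH⟩ := ih
    have h2 : (!![1, 1; 1, -1] : Matrix (Fin 2) (Fin 2) ℝ).IsHadamard := by
      refine ⟨fun i j => ?_, ?_, ?_⟩
      · fin_cases i <;> fin_cases j <;> simp [Unitary.mem_iff]
      all_goals
        ext i j
        fin_cases i <;> fin_cases j <;> norm_num [mul_apply, Fin.sum_univ_two]
    exact ⟨_, (hH.kronecker h2).reindex (finProdFinEquiv.trans (finCongr (pow_succ 2 k).symm))
      (finProdFinEquiv.trans (finCongr (pow_succ 2 k).symm))⟩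

lemma StrictNash.eq_of_line {n : ℕ} {A B : Matrix (Fin n) (Fin n) ℝ} {I J : Finset (Fin n)}
    {p q : Fin n × Fin n} (hp : StrictNash A B I J p.1 p.2) (hq : StrictNash A B I J q.1 q.2)
    (hline : (I : Set (Fin n)).Subsingleton ∨ (J : Set (Fin n)).Subsingleton) : p = q := by
  obtain ⟨hpI, hpJ, hpA, hpB⟩ := hp
  obtain ⟨hqI, hqJ, hqA, hqB⟩ := hq
  rcases hline with h | h
  · have h1 : p.1 = q.1 := h hpI hqI
    refine Prod.ext h1 ?_
    by_contra hne
    have h2 := hpB _ hqJ (Ne.symm hne)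
    have h3 := hqB _ hpJ hne
    rw [h1] at h2
    exact lt_asymm h2 h3
  · have h1 : p.2 = q.2 := h hpJ hqJ
    refine Prod.ext ?_ h1
    by_contra hne
    have h2 := hpA _ hqI (Ne.symm hne)
    have h3 := hqA _ hpI hne
    rw [h1] at h2
    exact lt_asymm h2 h3

/-- A rationalizable data set in which one player never has a choice is unique. -/
lemma UniqueProp.of_rationalizable_of_line {n : ℕ} {T : Finset (Obs n)} (hT : Rationalizable T)
    (hline : ∀ o ∈ T, (o.2.1 : Set (Fin n)).Subsingleton ∨ (o.2.2 : Set (Fin n)).Subsingleton) :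
    UniqueProp T := by
  obtain ⟨A, B, hAB⟩ := hT
  refine ⟨fun o ho o' ho' h => ?_, fun o ho o' ho' hsub hmem => ?_⟩
  · have h1 := hAB o' ho'
    rw [← h] at h1
    exact (hAB o ho).eq_of_line h1 (hline o ho)
  · obtain ⟨-, -, hA, hB⟩ := hAB o ho
    rw [Finset.mem_product] at hmem
    refine (hAB o' ho').eq_of_line ⟨hmem.1, hmem.2, fun i hi => hA i ?_, fun j hj => hB j ?_⟩
      (hline o' ho')
    · exact (Finset.mem_product.1 (hsub (Finset.mk_mem_product hi hmem.2))).1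
    · exact (Finset.mem_product.1 (hsub (Finset.mk_mem_product hmem.1 hj))).2

open Classical in
/-- The data set revealing, for every profile `(i, j)` with `0 < G i j`, that the row player
prefers `i` to `f i` against `j`, and the column player prefers `j` to `f j` against `i`. -/
noncomputable def lineDataset {n : ℕ} (G : Matrix (Fin n) (Fin n) ℝ) (f : Fin n → Fin n) :
    Finset (Obs n) :=
  Finset.univ.filter fun o => 0 < G o.1.1 o.1.2 ∧
    ((o.2.1 = {o.1.1, f o.1.1} ∧ o.2.2 = {o.1.2}) ∨
      (o.2.1 = {o.1.1} ∧ o.2.2 = {o.1.2, f o.1.2}))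

lemma mem_lineDataset {n : ℕ} {G : Matrix (Fin n) (Fin n) ℝ} {f : Fin n → Fin n} {o : Obs n} :
    o ∈ lineDataset G f ↔ 0 < G o.1.1 o.1.2 ∧
    ((o.2.1 = {o.1.1, f o.1.1} ∧ o.2.2 = {o.1.2}) ∨
      (o.2.1 = {o.1.1} ∧ o.2.2 = {o.1.2, f o.1.2})) := by
  simp [lineDataset]

section lineDataset

variable {n : ℕ} {G : Matrix (Fin n) (Fin n) ℝ} {f : Fin n → Fin n}

lemma isDataset_lineDataset : IsDataset (lineDataset G f) := by
  intro o ho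
  rcases (mem_lineDataset.1 ho).2 with ⟨h1, h2⟩ | ⟨h1, h2⟩ <;> simp [h1, h2]

lemma rationalizes_lineDataset (hrow : ∀ i j, G (f i) j = -G i j)
    (hcol : ∀ i j, G i (f j) = -G i j) : Rationalizes G G (lineDataset G f) := by
  intro o ho
  obtain ⟨hpos, ⟨h1, h2⟩ | ⟨h1, h2⟩⟩ := mem_lineDataset.1 ho
  · refine ⟨by simp [h1], by simp [h2], fun i hi hne => ?_, fun j hj hne => ?_⟩
    · rw [h1, Finset.mem_insert, Finset.mem_singleton] at hi
      rw [hi.resolve_left hne, hrow]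
      linarith
    · rw [h2, Finset.mem_singleton] at hj
      exact absurd hj hne
  · refine ⟨by simp [h1], by simp [h2], fun i hi hne => ?_, fun j hj hne => ?_⟩
    · rw [h1, Finset.mem_singleton] at hi
      exact absurd hi hne
    · rw [h2, Finset.mem_insert, Finset.mem_singleton] at hj
      rw [hj.resolve_left hne, hcol]
      linarith

lemma uniqueProp_lineDataset (hrow : ∀ i j, G (f i) j = -G i j)
    (hcol : ∀ i j, G i (f j) = -G i j) : UniqueProp (lineDataset G f) := by
  refine UniqueProp.of_rationalizable_of_line ⟨G, G, rationalizes_lineDataset hrow hcol⟩ ?_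
  intro o ho
  rcases (mem_lineDataset.1 ho).2 with ⟨h1, h2⟩ | ⟨h1, h2⟩
  · exact Or.inr (by simp [h2])
  · exact Or.inl (by simp [h1])

lemma Rationalizes.lt_of_lineDataset {A B : Matrix (Fin n) (Fin n) ℝ}
    (h : Rationalizes A B (lineDataset G f)) (hf : ∀ i, f i ≠ i) {i j : Fin n}
    (hG : 0 < G i j) : A (f i) j < A i j ∧ B i (f j) < B i j := by
  constructor
  · exact (h ((i, j), {i, f i}, {j}) (mem_lineDataset.2 ⟨hG, Or.inl ⟨rfl, rfl⟩⟩)).2.2.1 (f i)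
      (by simp) (hf i)
  · exact (h ((i, j), {i}, {j, f j}) (mem_lineDataset.2 ⟨hG, Or.inr ⟨rfl, rfl⟩⟩)).2.2.2 (f j)
      (by simp) (hf j)

end lineDataset

/-- The sign attached to a copy of a strategy. -/
def copySign (s : Bool) : ℝ := if s then -1 else 1

/-- The matrix taking second differences over the two copies of each strategy has rank at most
that of the original matrix. -/
lemma rank_second_difference_le {ι κ : Type*} [Fintype ι] [DecidableEq ι] [Fintype κ]
    [DecidableEq κ] (φ : κ ≃ ι × Bool) (C : Matrix κ κ ℝ) :
    (Matrix.of fun a b => C (φ.symm (a, false)) (φ.symm (b, false)) -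
      C (φ.symm (a, true)) (φ.symm (b, false)) - C (φ.symm (a, false)) (φ.symm (b, true)) +
      C (φ.symm (a, true)) (φ.symm (b, true))).rank ≤ C.rank := by
  set P : Matrix ι (ι × Bool) ℝ := Matrix.of fun a p => if p.1 = a then copySign p.2 else 0
  have h : (Matrix.of fun a b => C (φ.symm (a, false)) (φ.symm (b, false)) -
      C (φ.symm (a, true)) (φ.symm (b, false)) - C (φ.symm (a, false)) (φ.symm (b, true)) +
      C (φ.symm (a, true)) (φ.symm (b, true))) = P * C.submatrix φ.symm φ.symm * Pᵀ := by
    ext a b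
    simp [P, mul_apply, Fintype.sum_prod_type, copySign, ite_mul]
    ring
  rw [h]
  exact (rank_mul_le_left _ _).trans ((rank_mul_le_right _ _).trans (rank_submatrix _ _ _).le)

/-- For every `k ≥ 1` and `n = 2^(k+1)`, there exists a rationalizable
data set `T` over an `n × n` strategy space satisfying the uniqueness property such that
every bimatrix game `(A,B)` that rationalizes `T` satisfies `rank (A+B) ≥ √(n/2)`. -/
theorem high_rank_unique_datasets_exist (k n : ℕ) (hk : 1 ≤ k) (hn : n = 2 ^ (k + 1)) :
    ∃ T : Finset (Obs n), IsDataset T ∧ UniqueProp T ∧ Rationalizable T ∧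
      ∀ A B : Matrix (Fin n) (Fin n) ℝ, Rationalizes A B T →
        Real.sqrt ((n : ℝ) / 2) ≤ ((A + B).rank : ℝ) := by
  obtain ⟨H, hH⟩ := exists_isHadamard_two_pow k
  let φ : Fin n ≃ Fin (2 ^ k) × Bool := Fintype.equivOfCardEq (by simp [hn, pow_succ])
  let f : Fin n → Fin n := fun i => φ.symm ((φ i).1, !(φ i).2)
  let G : Matrix (Fin n) (Fin n) ℝ := Matrix.of fun i j =>
    copySign (φ i).2 * copySign (φ j).2 * H (φ i).1 (φ j).1
  have hnot : ∀ s, copySign (!s) = -copySign s := by simp [copySign]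
  have hf : ∀ i, f i ≠ i := fun i h => by
    have := congrArg (fun i => (φ i).2) h
    simp [f] at this
  have hrow : ∀ i j, G (f i) j = -G i j := fun i j => by simp [G, f, hnot]
  have hcol : ∀ i j, G i (f j) = -G i j := fun i j => by simp [G, f, hnot]
  refine ⟨lineDataset G f, isDataset_lineDataset, uniqueProp_lineDataset hrow hcol,
    ⟨G, G, rationalizes_lineDataset hrow hcol⟩, fun A B hAB => ?_⟩
  have hff : ∀ a s, f (φ.symm (a, s)) = φ.symm (a, !s) := by simp [f]
  have hG : ∀ a b s t, G (φ.symm (a, s)) (φ.symm (b, t)) =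
      copySign s * copySign t * H a b := by simp [G]
  have hlt : ∀ a b s t, 0 < copySign s * copySign t * H a b →
      A (φ.symm (a, !s)) (φ.symm (b, t)) < A (φ.symm (a, s)) (φ.symm (b, t)) ∧
      B (φ.symm (a, s)) (φ.symm (b, !t)) < B (φ.symm (a, s)) (φ.symm (b, t)) := by
    intro a b s t h
    rw [← hG] at h
    simpa only [hff] using hAB.lt_of_lineDataset hf h
  have hrank := card_le_rank_sq_of_isHadamard hH (Matrix.of fun a b =>
      (A + B) (φ.symm (a, false)) (φ.symm (b, false)) -
      (A + B) (φ.symm (a, true)) (φ.symm (b, false)) -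
      (A + B) (φ.symm (a, false)) (φ.symm (b, true)) +
      (A + B) (φ.symm (a, true)) (φ.symm (b, true))) (fun a b => by
    have hunit : H a b * H a b = 1 := by simpa using (hH.apply_mem a b).1
    simp only [of_apply, Matrix.add_apply]
    rcases mul_self_eq_one_iff.1 hunit with h | h
    · have h1 := hlt a b false false (by simp [copySign, h])
      have h2 := hlt a b true true (by simp [copySign, h])
      simp only [Bool.not_false, Bool.not_true] at h1 h2
      rw [h]
      linarith
    · have h1 := hlt a b false true (by simp [copySign, h])
      have h2 := hlt a b true false (by simp [copySign, h])
      simp only [Bool.not_false, Bool.not_true] at h1 h2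
      rw [h]
      linarith)
  rw [Fintype.card_fin] at hrank
  have hle : 2 ^ k ≤ (A + B).rank ^ 2 :=
    hrank.trans (Nat.pow_le_pow_left (rank_second_difference_le φ (A + B)) 2)
  refine Real.sqrt_le_iff.2 ⟨Nat.cast_nonneg _, ?_⟩
  have hn2 : (n : ℝ) / 2 = ((2 ^ k : ℕ) : ℝ) := by
    rw [hn, pow_succ]
    push_cast
    ring
  rw [hn2]
  exact_mod_cast hle
end

section
/- Let T be a rationalizable data set over an n × n strategy space that satisfies the uniqueness property, and let k be the crossing span of T. Then there exists a bimatrix game (A,B) that rationalizes T with rank(A+B) ≤ k. -/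
/-- Two subgames `(I,J)` and `(I',J')` cross: `(I×J) ∩ (I'×J') ≠ ∅` but neither product
set contains the other. -/
def Cross {n : ℕ} (S S' : Finset (Fin n) × Finset (Fin n)) : Prop :=
  ((S.1 ×ˢ S.2) ∩ (S'.1 ×ˢ S'.2)).Nonempty ∧
    ¬ (S.1 ×ˢ S.2 ⊆ S'.1 ×ˢ S'.2) ∧ ¬ (S'.1 ×ˢ S'.2 ⊆ S.1 ×ˢ S.2)

/-- A data set is laminar if no two of its subgames cross. -/
def Laminar {n : ℕ} (T : Finset (Obs n)) : Prop :=
  ∀ o ∈ T, ∀ o' ∈ T, ¬ Cross o.2 o'.2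

/-- The observed choices of observations of `T` whose subgame crosses some subgame
appearing in `T`. -/
def crossingChoices {n : ℕ} (T : Finset (Obs n)) : Set (Fin n × Fin n) :=
  {p | ∃ o ∈ T, o.1 = p ∧ ∃ o' ∈ T, Cross o.2 o'.2}

/-- The set of cells of the subgame of an observation. -/
abbrev Obs.cells {n : ℕ} (o : Obs n) : Finset (Fin n × Fin n) := o.2.1 ×ˢ o.2.2

/-- A finite relation without cycles admits a strictly monotone real-valued potential. -/
theorem exists_potential_of_acyclic {α : Type*} [Finite α] (r : α → α → Prop)
    (hr : ∀ x, ¬ Relation.TransGen r x x) : ∃ f : α → ℝ, ∀ x y, r x y → f x < f y := by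
  refine ⟨fun x => ({z | Relation.TransGen r z x}.ncard : ℝ), fun x y hxy => ?_⟩
  refine Nat.cast_lt.2 (Set.ncard_lt_ncard ?_ (Set.toFinite _))
  exact ⟨fun z hz => hz.tail hxy, fun h => hr x (h (Relation.TransGen.single hxy))⟩

/-- Adding a large multiple of a function turns all its increments of at least one into strict
increments of the sum. -/
theorem exists_scale {α : Type*} [Finite α] (f φ : α → ℝ) :
    ∃ K : ℝ, ∀ x y, φ x + 1 ≤ φ y → f x + K * φ x < f y + K * φ y := by
  obtain ⟨K, hK⟩ := (Set.finite_range fun p : α × α => f p.1 - f p.2).bddAbove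
  have hK' : ∀ x y, f x - f y ≤ K := fun x y => hK ⟨(x, y), rfl⟩
  refine ⟨K + 1, fun x y h => ?_⟩
  have h0 := hK' x x
  have h1 := hK' x y
  nlinarith

/-- The subgames of two observations that do not cross are nested or disjoint. -/
theorem nested_or_disjoint_of_not_cross {n : ℕ} {o o' : Obs n} (h : ¬ Cross o.2 o'.2) :
    o.cells ⊆ o'.cells ∨ o'.cells ⊆ o.cells ∨ Disjoint o.cells o'.cells := by
  by_contra! hc
  exact h ⟨Finset.not_disjoint_iff_nonempty_inter.1 hc.2.2, hc.1, hc.2.1⟩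

/-- The subgames of two observations that share a cell and do not cross are nested. -/
theorem nested_of_not_cross {n : ℕ} {o o' : Obs n} (h : ¬ Cross o.2 o'.2) {x : Fin n × Fin n}
    (hx : x ∈ o.cells) (hx' : x ∈ o'.cells) : o.cells ⊆ o'.cells ∨ o'.cells ⊆ o.cells := by
  rcases nested_or_disjoint_of_not_cross h with h | h | h
  · exact .inl h
  · exact .inr h
  · exact absurd hx' (Finset.disjoint_left.1 h hx)

/-- For an observation `o` that crosses no observation of `s`, and whose subgame is contained in
no larger subgame of `s`, there is a function that increases along the zero-sum constraints of `o`,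
and that, for each observation of `s`, either has the same choice as `o` and lies inside it, or is
constant on its subgame. -/
theorem exists_shift {n : ℕ} (o : Obs n) (s : Finset (Obs n)) (hlam : Laminar s)
    (ho : ∀ o' ∈ s, ¬ Cross o'.2 o.2) (hmax : ∀ o' ∈ s, o'.cells.card ≤ o.cells.card)
    (huniq : ∀ o' ∈ s, o'.cells ⊆ o.cells → o.1 ∈ o'.cells → o'.1 = o.1) :
    ∃ φ : Fin n × Fin n → ℝ,
      (∀ i ∈ o.2.1, o.1.2 ∈ o.2.2 → i ≠ o.1.1 → φ (i, o.1.2) + 1 ≤ φ o.1) ∧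
      (∀ j ∈ o.2.2, o.1.1 ∈ o.2.1 → j ≠ o.1.2 → φ o.1 + 1 ≤ φ (o.1.1, j)) ∧
      ∀ o' ∈ s, (o'.1 = o.1 ∧ o'.cells ⊆ o.cells) ∨
        ∀ x ∈ o'.cells, ∀ y ∈ o'.cells, φ x = φ y := by
  classical
  obtain ⟨⟨a, b⟩, I, J⟩ := o
  let up : Fin n × Fin n → Prop := fun x => x ∈ I ×ˢ J ∧ ((x.1 = a ∧ x.2 ≠ b) ∨
    ∃ o' ∈ s, (a, b) ∉ o'.cells ∧ x ∈ o'.cells ∧ a ∈ o'.2.1)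
  let down : Fin n × Fin n → Prop := fun x => x ∈ I ×ˢ J ∧ ((x.2 = b ∧ x.1 ≠ a) ∨
    ∃ o' ∈ s, (a, b) ∉ o'.cells ∧ x ∈ o'.cells ∧ b ∈ o'.2.2)
  have hdisj : ∀ x, up x → ¬ down x := by
    rintro ⟨x, y⟩ ⟨-, hu⟩ ⟨-, hd⟩
    rcases hu with ⟨rfl, hu⟩ | ⟨p, hp, hcp, hxp, hap⟩ <;>
      rcases hd with ⟨rfl, hd⟩ | ⟨q, hq, hcq, hxq, haq⟩
    · exact hd rfl
    · exact hcq (Finset.mem_product.2 ⟨(Finset.mem_product.1 hxq).1, haq⟩)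
    · exact hcp (Finset.mem_product.2 ⟨hap, (Finset.mem_product.1 hxp).2⟩)
    · simp only [Finset.mem_product] at hxp hxq hcp hcq
      rcases nested_of_not_cross (hlam p hp q hq) (x := (x, y))
        (Finset.mem_product.2 hxp) (Finset.mem_product.2 hxq) with h | h
      · exact hcq ⟨(Finset.mem_product.1
          (h (Finset.mk_mem_product hap hxp.2))).1, haq⟩
      · exact hcp ⟨hap, (Finset.mem_product.1
          (h (Finset.mk_mem_product hxq.1 haq))).2⟩
  have hupc : ¬ up (a, b) := by
    rintro ⟨-, h | ⟨p, -, h1, h2, -⟩⟩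
    · exact h.2 rfl
    · exact h1 h2
  have hdownc : ¬ down (a, b) := by
    rintro ⟨-, h | ⟨p, -, h1, h2, -⟩⟩
    · exact h.2 rfl
    · exact h1 h2
  refine ⟨fun x => if up x then 1 else if down x then -1 else 0, ?_, ?_, ?_⟩
  · intro i hi hb hne
    have hd : down (i, b) := ⟨Finset.mem_product.2 ⟨hi, hb⟩, .inl ⟨rfl, hne⟩⟩
    have hu : ¬ up (i, b) := fun h => hdisj _ h hd
    simp [hd, hu, hupc, hdownc]
  · intro j hj ha hne
    have hu : up (a, j) := ⟨Finset.mem_product.2 ⟨ha, hj⟩, .inl ⟨rfl, hne⟩⟩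
    simp [hu, hupc, hdownc]
  · intro o' ho'
    have hcase : o'.cells ⊆ I ×ˢ J ∨ Disjoint o'.cells (I ×ˢ J) := by
      rcases nested_or_disjoint_of_not_cross (ho o' ho') with h | h | h
      · exact .inl h
      · exact .inl (Finset.eq_of_subset_of_card_le h (hmax o' ho')).symm.subset
      · exact .inr h
    rcases hcase with hsub | hdis
    · by_cases hc : (a, b) ∈ o'.cells
      · exact .inl ⟨huniq o' ho' hsub hc, hsub⟩
      right
      have hup : ∀ x ∈ o'.cells, ∀ y ∈ o'.cells, up x → up y := by
        rintro x hx y hy ⟨-, ⟨h, -⟩ | ⟨p, hp, hcp, hxp, hap⟩⟩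
        · exact ⟨hsub hy, .inr ⟨o', ho', hc, hy, h ▸ (Finset.mem_product.1 hx).1⟩⟩
        · refine ⟨hsub hy, .inr ?_⟩
          rcases nested_of_not_cross (hlam p hp o' ho') hxp hx with h | h
          · exact ⟨o', ho', hc, hy, (Finset.mem_product.1 (h (Finset.mk_mem_product hap
              (Finset.mem_product.1 hxp).2))).1⟩
          · exact ⟨p, hp, hcp, h hy, hap⟩
      have hdown : ∀ x ∈ o'.cells, ∀ y ∈ o'.cells, down x → down y := by
        rintro x hx y hy ⟨-, ⟨h, -⟩ | ⟨p, hp, hcp, hxp, hap⟩⟩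
        · exact ⟨hsub hy, .inr ⟨o', ho', hc, hy, h ▸ (Finset.mem_product.1 hx).2⟩⟩
        · refine ⟨hsub hy, .inr ?_⟩
          rcases nested_of_not_cross (hlam p hp o' ho') hxp hx with h | h
          · exact ⟨o', ho', hc, hy, (Finset.mem_product.1 (h (Finset.mk_mem_product
              (Finset.mem_product.1 hxp).1 hap))).2⟩
          · exact ⟨p, hp, hcp, h hy, hap⟩
      intro x hx y hy
      have h1 : up x ↔ up y := ⟨hup x hx y hy, hup y hy x hx⟩
      have h2 : down x ↔ down y := ⟨hdown x hx y hy, hdown y hy x hx⟩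
      simp only [h1, h2]
    · right
      have hz : ∀ x ∈ o'.cells, ¬ up x ∧ ¬ down x := fun x hx =>
        ⟨fun h => Finset.disjoint_left.1 hdis hx h.1, fun h => Finset.disjoint_left.1 hdis hx h.1⟩
      intro x hx y hy
      simp [hz x hx, hz y hy]

/-- A laminar data set with the uniqueness property is rationalized by a zero-sum game. -/
theorem exists_zeroSum_of_laminar {n : ℕ} (T : Finset (Obs n)) (hT : IsDataset T)
    (hlam : Laminar T) (huniq : UniqueProp T) :
    ∃ M : Matrix (Fin n) (Fin n) ℝ, Rationalizes M (-M) T := by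
  classical
  induction T using Finset.induction_on_max_value (fun o : Obs n => o.cells.card) with
  | empty => exact ⟨0, fun o ho => absurd ho (Finset.notMem_empty o)⟩
  | insert o s _ hmax ih =>
    have hs : ∀ p ∈ s, p ∈ insert o s := fun p hp => Finset.mem_insert_of_mem hp
    have ho := Finset.mem_insert_self o s
    have hlam' : Laminar s := fun p hp q hq => hlam p (hs p hp) q (hs q hq)
    obtain ⟨M, hM⟩ := ih (fun p hp => hT p (hs p hp)) hlam'
      ⟨fun p hp q hq => huniq.1 p (hs p hp) q (hs q hq),
        fun p hp q hq => huniq.2 p (hs p hp) q (hs q hq)⟩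
    obtain ⟨φ, hcol, hrow, hφ⟩ := exists_shift o s hlam' (fun p hp => hlam p (hs p hp) o ho) hmax
      (fun p hp => huniq.2 o ho p (hs p hp))
    obtain ⟨K, hK⟩ := exists_scale (fun x : Fin n × Fin n => M x.1 x.2) φ
    obtain ⟨ho1, ho2⟩ := hT o ho
    refine ⟨Matrix.of fun i j => M i j + K * φ (i, j), fun p hp => ?_⟩
    obtain ⟨hp1, hp2⟩ := hT p hp
    refine ⟨hp1, hp2, ?_⟩
    simp only [Matrix.neg_apply, Matrix.of_apply, neg_lt_neg_iff]
    have hsame : p.1 = o.1 ∧ p.cells ⊆ o.cells →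
        (∀ i' ∈ p.2.1, i' ≠ p.1.1 →
          M i' p.1.2 + K * φ (i', p.1.2) < M p.1.1 p.1.2 + K * φ (p.1.1, p.1.2)) ∧
        ∀ j' ∈ p.2.2, j' ≠ p.1.2 →
          M p.1.1 p.1.2 + K * φ (p.1.1, p.1.2) < M p.1.1 j' + K * φ (p.1.1, j') := by
      rintro ⟨heq, hsub⟩
      constructor
      · intro i hi hne
        have h := (Finset.mem_product.1 (hsub (Finset.mk_mem_product hi hp2))).1
        rw [heq] at hne ⊢
        exact hK (i, o.1.2) o.1 (hcol i h ho2 hne)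
      · intro j hj hne
        have h := (Finset.mem_product.1 (hsub (Finset.mk_mem_product hp1 hj))).2
        rw [heq] at hne ⊢
        exact hK o.1 (o.1.1, j) (hrow j h ho1 hne)
    rcases Finset.mem_insert.1 hp with rfl | hps
    · exact hsame ⟨rfl, subset_rfl⟩
    rcases hφ p hps with h | hconst
    · exact hsame h
    obtain ⟨-, -, hMc, hMr⟩ := hM p hps
    constructor
    · intro i hi hne
      rw [hconst (i, p.1.2) (Finset.mem_product.2 ⟨hi, hp2⟩) (p.1.1, p.1.2)
        (Finset.mem_product.2 ⟨hp1, hp2⟩)]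
      exact (add_lt_add_iff_right _).2 (hMc i hi hne)
    · intro j hj hne
      rw [hconst (p.1.1, j) (Finset.mem_product.2 ⟨hp1, hj⟩) (p.1.1, p.1.2)
        (Finset.mem_product.2 ⟨hp1, hp2⟩)]
      exact (add_lt_add_iff_right _).2 (neg_lt_neg_iff.1 (hMr j hj hne))

/-- The column constraint `A x < A y` imposed by the observation `o` on the first player. -/
def ColEdge {n : ℕ} (o : Obs n) (x y : Fin n × Fin n) : Prop :=
  o.1 = y ∧ x.2 = y.2 ∧ x.1 ∈ o.2.1 ∧ x.1 ≠ y.1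

/-- The row constraint `A x < A y` imposed by the observation `o` on the second player in a
zero-sum game. -/
def RowEdge {n : ℕ} (o : Obs n) (x y : Fin n × Fin n) : Prop :=
  o.1 = x ∧ y.1 = x.1 ∧ y.2 ∈ o.2.2 ∧ y.2 ≠ x.2

/-- All column constraints together with the row constraints outside the rows of crossing choices
can be satisfied simultaneously. -/
theorem exists_zeroSum_off_crossing_rows {n : ℕ} (T : Finset (Obs n)) (hT : IsDataset T)
    (hrat : Rationalizable T) (huniq : UniqueProp T) (R : Set (Fin n))
    (hR : ∀ o ∈ T, o.1.1 ∉ R → ∀ o' ∈ T, ¬ Cross o.2 o'.2) :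
    ∃ f : Fin n × Fin n → ℝ, ∀ x y,
      (∃ o ∈ T, ColEdge o x y ∨ (o.1.1 ∉ R ∧ RowEdge o x y)) → f x < f y := by
  classical
  obtain ⟨A, B, hAB⟩ := hrat
  have hA : ∀ o ∈ T, ∀ x y, ColEdge o x y → A x.1 x.2 < A y.1 y.2 := by
    rintro o ho ⟨x1, x2⟩ y ⟨rfl, h1, h2, h3⟩
    dsimp only at h1 h2 h3 ⊢
    exact h1 ▸ (hAB o ho).2.2.1 x1 h2 h3
  set T₀ := T.filter fun o => o.1.1 ∉ R
  have hsub : ∀ o ∈ T₀, o ∈ T := fun o ho => (Finset.mem_filter.1 ho).1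
  obtain ⟨M, hM⟩ := exists_zeroSum_of_laminar T₀ (fun o ho => hT o (hsub o ho))
    (fun o ho o' ho' => hR o (hsub o ho) (Finset.mem_filter.1 ho).2 o' (hsub o' ho'))
    ⟨fun p hp q hq => huniq.1 p (hsub p hp) q (hsub q hq),
      fun p hp q hq => huniq.2 p (hsub p hp) q (hsub q hq)⟩
  set r : Fin n × Fin n → Fin n × Fin n → Prop := fun x y =>
    ∃ o ∈ T, ColEdge o x y ∨ (o.1.1 ∉ R ∧ RowEdge o x y)
  have hMr : ∀ x y, y.1 ∉ R → r x y → M x.1 x.2 < M y.1 y.2 := by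
    rintro ⟨x1, x2⟩ ⟨y1, y2⟩ hy ⟨o, ho, ⟨h1, h2, h3, h4⟩ | ⟨h0, h1, h2, h3, h4⟩⟩
    · have hm := (hM o (Finset.mem_filter.2 ⟨ho, h1 ▸ hy⟩)).2.2.1 x1 h3 (h1 ▸ h4)
      dsimp only at h2
      rw [h1] at hm
      rw [h2]
      exact hm
    · have hm := (hM o (Finset.mem_filter.2 ⟨ho, h0⟩)).2.2.2 y2 h3 (h1 ▸ h4)
      dsimp only at h2
      rw [h1] at hm
      rw [h2]
      exact neg_lt_neg_iff.1 hm
  have hpath : ∀ x y, Relation.TransGen r x y → y.1 ∉ R →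
      ∃ w, w.1 ∉ R ∧ r x w ∧ M w.1 w.2 ≤ M y.1 y.2 := by
    intro x y hxy hy
    induction hxy using Relation.TransGen.head_induction_on with
    | single h => exact ⟨y, hy, h, le_rfl⟩
    | @head x z hxz _ ih =>
      obtain ⟨w, hw, hzw, hwy⟩ := ih
      by_cases hz : z.1 ∈ R
      · refine ⟨w, hw, ?_, hwy⟩
        obtain ⟨o₂, ho₂, hc₂ | ⟨-, hr₂⟩⟩ := hzw
        swap
        · exact absurd hz (hr₂.2.1 ▸ hw)
        obtain ⟨o₁, ho₁, hc₁ | ⟨h1, hr₁⟩⟩ := hxz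
        swap
        · exact absurd hz (by rw [hr₁.2.1, ← hr₁.1]; exact h1)
        have hlt₁ := hA o₁ ho₁ x z hc₁
        have hlt₂ := hA o₂ ho₂ z w hc₂
        have hnc : ¬ Cross o₂.2 o₁.2 := hR o₂ ho₂ (hc₂.1 ▸ hw) o₁ ho₁
        have hd₁ := hT o₁ ho₁
        have hd₂ := hT o₂ ho₂
        obtain ⟨a1, a2, a3, a4⟩ := hc₁
        obtain ⟨b1, b2, b3, b4⟩ := hc₂
        rw [a1] at hd₁
        rw [b1] at hd₂
        rcases nested_of_not_cross hnc (x := z) (Finset.mem_product.2 ⟨b3, b2 ▸ hd₂.2⟩)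
          (Finset.mem_product.2 hd₁) with h | h
        · have hw₁ := (Finset.mem_product.1 (h (Finset.mem_product.2 hd₂))).1
          exact absurd hlt₂ (hA o₁ ho₁ w z ⟨a1, b2.symm, hw₁, b4.symm⟩).not_gt
        · have hx₂ := (Finset.mem_product.1 (h (Finset.mk_mem_product a3 (a2 ▸ hd₁.2)))).1
          refine ⟨o₂, ho₂, .inl ⟨b1, a2.trans b2, hx₂, fun hxw => ?_⟩⟩
          rw [hxw, a2.trans b2] at hlt₁
          exact hlt₁.not_gt hlt₂
      · exact ⟨z, hz, hxz, (hMr z w hw hzw).le.trans hwy⟩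
  have hsplit : ∀ x y, Relation.TransGen r x y →
      (∃ w, w.1 ∉ R ∧ Relation.TransGen r x w ∧ Relation.ReflTransGen r w y) ∨
        A x.1 x.2 < A y.1 y.2 := by
    have hstep : ∀ x y, r x y → y.1 ∈ R → A x.1 x.2 < A y.1 y.2 := by
      rintro x y ⟨o, ho, h | ⟨h, h'⟩⟩ hy
      · exact hA o ho x y h
      · rw [h'.2.1, ← h'.1] at hy
        exact absurd hy h
    intro x y hxy
    induction hxy with
    | @single y h =>
      by_cases hy : y.1 ∈ R
      · exact .inr (hstep x y h hy)
      · exact .inl ⟨y, hy, .single h, .refl⟩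
    | @tail y z hxy h ih =>
      rcases ih with ⟨w, hw, h1, h2⟩ | ih
      · exact .inl ⟨w, hw, h1, h2.tail h⟩
      · by_cases hz : z.1 ∈ R
        · exact .inr (ih.trans (hstep y z h hz))
        · exact .inl ⟨z, hz, hxy.tail h, .refl⟩
  refine exists_potential_of_acyclic r fun x hx => ?_
  rcases hsplit x x hx with ⟨w, hw, h1, h2⟩ | h
  · obtain ⟨v, hv, hwv, hle⟩ := hpath w w (h1.trans_right h2) hw
    exact (hMr w v hv hwv).not_ge hle
  · exact lt_irrefl _ h

/-- The rank of a matrix is at most the number of rows outside of which it vanishes. -/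
theorem Matrix.rank_le_ncard_of_rows_eq_zero {n : ℕ} (C : Matrix (Fin n) (Fin n) ℝ)
    (R : Set (Fin n)) (h : ∀ i ∉ R, ∀ j, C i j = 0) : C.rank ≤ R.ncard := by
  classical
  have hC : C = Matrix.diagonal (fun i => if i ∈ R then (1 : ℝ) else 0) * C := by
    ext i j
    by_cases hi : i ∈ R
    · simp [hi]
    · simp [hi, h i hi j]
  rw [hC]
  refine (Matrix.rank_mul_le_left _ _).trans ?_
  rw [Matrix.rank_diagonal, ← Nat.card_eq_fintype_card, ← Nat.card_coe_set_eq]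
  simp

/-- A rationalizable data set with the uniqueness property is rationalized by a game whose rank
is at most the number of rows of crossing choices. -/
theorem exists_rank_le_crossing_rows {n : ℕ} (T : Finset (Obs n)) (hT : IsDataset T)
    (hrat : Rationalizable T) (huniq : UniqueProp T) :
    ∃ A B : Matrix (Fin n) (Fin n) ℝ, Rationalizes A B T ∧
      (A + B).rank ≤ {i : Fin n | ∃ j, (i, j) ∈ crossingChoices T}.ncard := by
  classical
  set R := {i : Fin n | ∃ j, (i, j) ∈ crossingChoices T}
  obtain ⟨f, hf⟩ := exists_zeroSum_off_crossing_rows T hT hrat huniq R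
    (fun o ho hoR o' ho' hc => hoR ⟨o.1.2, o, ho, rfl, o', ho', hc⟩)
  obtain ⟨A₀, B₀, h₀⟩ := hrat
  refine ⟨Matrix.of fun i j => f (i, j),
    Matrix.of fun i j => if i ∈ R then B₀ i j else -f (i, j), ?_, ?_⟩
  · intro o ho
    obtain ⟨h1, h2⟩ := hT o ho
    refine ⟨h1, h2, fun i hi hne => ?_, fun j hj hne => ?_⟩
    · exact hf (i, o.1.2) o.1 ⟨o, ho, .inl ⟨rfl, rfl, hi, hne⟩⟩
    · by_cases hR : o.1.1 ∈ R
      · simpa only [Matrix.of_apply, hR, if_true] using (h₀ o ho).2.2.2 j hj hne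
      · simpa only [Matrix.of_apply, hR, if_false, neg_lt_neg_iff] using
          hf o.1 (o.1.1, j) ⟨o, ho, .inr ⟨hR, rfl, rfl, hj, hne⟩⟩
  · refine Matrix.rank_le_ncard_of_rows_eq_zero _ R fun i hi j => ?_
    simp [hi]

/-- Exchanging the two players in an observation. -/
def Obs.flip {n : ℕ} (o : Obs n) : Obs n := (o.1.swap, o.2.swap)

theorem Obs.flip_cells_subset {n : ℕ} (o o' : Obs n) :
    o.flip.cells ⊆ o'.flip.cells ↔ o.cells ⊆ o'.cells := by
  simp only [Finset.subset_iff, Prod.forall, Finset.mem_product, Obs.flip, Prod.fst_swap,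
    Prod.snd_swap]
  exact ⟨fun h a b hab => (h b a hab.symm).symm, fun h a b hab => (h b a hab.symm).symm⟩

theorem Obs.flip_cross {n : ℕ} (o o' : Obs n) : Cross o.flip.2 o'.flip.2 ↔ Cross o.2 o'.2 := by
  refine and_congr ?_ (and_congr (not_congr (flip_cells_subset o o'))
    (not_congr (flip_cells_subset o' o)))
  simp only [Finset.Nonempty, Prod.exists, Finset.mem_inter, Finset.mem_product, Obs.flip,
    Prod.fst_swap, Prod.snd_swap]
  exact ⟨fun ⟨a, b, h, h'⟩ => ⟨b, a, h.symm, h'.symm⟩, fun ⟨a, b, h, h'⟩ => ⟨b, a, h.symm, h'.symm⟩⟩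

theorem Rationalizes.flip {n : ℕ} {A B : Matrix (Fin n) (Fin n) ℝ} {T : Finset (Obs n)}
    (h : Rationalizes A B T) : Rationalizes B.transpose A.transpose (T.image Obs.flip) := by
  intro o ho
  obtain ⟨o, hoT, rfl⟩ := Finset.mem_image.1 ho
  obtain ⟨h1, h2, h3, h4⟩ := h o hoT
  exact ⟨h2, h1, h4, h3⟩

theorem UniqueProp.flip {n : ℕ} {T : Finset (Obs n)} (h : UniqueProp T) :
    UniqueProp (T.image Obs.flip) := by
  simp only [UniqueProp, Finset.forall_mem_image]
  refine ⟨fun o ho o' ho' heq => ?_, fun o ho o' ho' hsub hmem => ?_⟩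
  · exact congrArg Prod.swap (h.1 o ho o' ho' (Prod.swap_injective heq))
  · exact congrArg Prod.swap (h.2 o ho o' ho' ((Obs.flip_cells_subset o' o).1 hsub)
      (Finset.mem_product.2 (Finset.mem_product.1 hmem).symm))

theorem swap_mem_crossingChoices_flip {n : ℕ} {T : Finset (Obs n)} {p : Fin n × Fin n}
    (h : p ∈ crossingChoices (T.image Obs.flip)) : p.swap ∈ crossingChoices T := by
  obtain ⟨_, ho, rfl, _, ho', hc⟩ := h
  obtain ⟨o, hoT, rfl⟩ := Finset.mem_image.1 ho
  obtain ⟨o', hoT', rfl⟩ := Finset.mem_image.1 ho'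
  exact ⟨o, hoT, rfl, o', hoT', (Obs.flip_cross o o').1 hc⟩

/-- A rationalizable data set with the uniqueness property is rationalized by a game whose rank
is at most the number of columns of crossing choices. -/
theorem exists_rank_le_crossing_cols {n : ℕ} (T : Finset (Obs n)) (hT : IsDataset T)
    (hrat : Rationalizable T) (huniq : UniqueProp T) :
    ∃ A B : Matrix (Fin n) (Fin n) ℝ, Rationalizes A B T ∧
      (A + B).rank ≤ {j : Fin n | ∃ i, (i, j) ∈ crossingChoices T}.ncard := by
  obtain ⟨A₀, B₀, h₀⟩ := hrat
  obtain ⟨A, B, hAB, hrank⟩ := exists_rank_le_crossing_rows (T.image Obs.flip)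
    (Finset.forall_mem_image.2 fun o ho => (hT o ho).symm) ⟨_, _, h₀.flip⟩ huniq.flip
  refine ⟨B.transpose, A.transpose, fun o ho => ?_, ?_⟩
  · exact hAB.flip o (Finset.mem_image.2 ⟨_, Finset.mem_image_of_mem _ ho, rfl⟩)
  · rw [← Matrix.transpose_add, Matrix.rank_transpose, add_comm]
    refine hrank.trans (Set.ncard_le_ncard ?_ (Set.toFinite _))
    rintro j ⟨i, h⟩
    exact ⟨i, swap_mem_crossingChoices_flip h⟩

/-- If `T` is a rationalizable data set satisfying the uniqueness
property, then some bimatrix game `(A,B)` rationalizes `T` with `rank (A+B)` at most the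
crossing span of `T`, i.e. the minimum of the number of rows and the number of columns
spanned by the observed choices of crossing subgames. -/
theorem rank_le_crossing_span (n : ℕ) (T : Finset (Obs n)) (hT : IsDataset T)
    (hrat : Rationalizable T) (huniq : UniqueProp T) :
    ∃ A B : Matrix (Fin n) (Fin n) ℝ, Rationalizes A B T ∧
      (A + B).rank ≤
        min {i : Fin n | ∃ j, (i, j) ∈ crossingChoices T}.ncard
            {j : Fin n | ∃ i, (i, j) ∈ crossingChoices T}.ncard := by
  rcases le_total {i : Fin n | ∃ j, (i, j) ∈ crossingChoices T}.ncard
      {j : Fin n | ∃ i, (i, j) ∈ crossingChoices T}.ncard with h | h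
  · rw [min_eq_left h]
    exact exists_rank_le_crossing_rows T hT hrat huniq
  · rw [min_eq_right h]
    exact exists_rank_le_crossing_cols T hT hrat huniq
end

section
/- Let n = 2^k and let H_n be the Sylvester Hadamard matrix of order n. Every real n×n matrix X whose sign pattern equals H_n (that is, X_{ij} · (H_n)_{ij} > 0 for all i,j) satisfies rank(X) ≥ √n. -/
/-- The Sylvester Hadamard matrix of order `2^k`: `H_1 = (1)` and
`H_{2m} = [[H_m, H_m], [H_m, -H_m]]`. -/
noncomputable def sylvester : (k : ℕ) → Matrix (Fin (2 ^ k)) (Fin (2 ^ k)) ℝ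
  | 0 => 1
  | (k + 1) =>
      Matrix.reindex (finSumFinEquiv.trans (finCongr (by ring : 2 ^ k + 2 ^ k = 2 ^ (k + 1))))
        (finSumFinEquiv.trans (finCongr (by ring : 2 ^ k + 2 ^ k = 2 ^ (k + 1))))
        (Matrix.fromBlocks (sylvester k) (sylvester k) (sylvester k) (-(sylvester k)))

open Matrix Finset

namespace Matrix

theorem exists_mul_eq_of_rank {m n K : Type*} [Fintype m] [Fintype n] [DecidableEq n] [Field K]
    (X : Matrix m n K) :
    ∃ (U : Matrix m (Fin X.rank) K) (V : Matrix (Fin X.rank) n K), U * V = X := by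
  let b : Module.Basis (Fin X.rank) K (LinearMap.range X.mulVecLin) :=
    Module.finBasis K (LinearMap.range X.mulVecLin)
  have hX (j : n) : X.col j ∈ LinearMap.range X.mulVecLin :=
    ⟨Pi.single j 1, by simp⟩
  refine ⟨of fun i k => (b k : m → K) i, of fun k j => b.repr ⟨X.col j, hX j⟩ k, ?_⟩
  ext i j
  have h := congrArg (fun v : LinearMap.range X.mulVecLin => (v : m → K) i)
    (b.sum_repr ⟨X.col j, hX j⟩)
  simp only [Submodule.coe_sum, Submodule.coe_smul, Finset.sum_apply, Pi.smul_apply,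
    smul_eq_mul, col_apply] at h
  simp only [mul_apply, of_apply, ← h, mul_comm]

/-- A weak form of Hadamard's determinant inequality. -/
theorem sq_det_le_sq_factorial_mul_prod_row {m : Type*} [Fintype m] [DecidableEq m]
    (B : Matrix m m ℝ) :
    B.det ^ 2 ≤ ((Fintype.card m).factorial : ℝ) ^ 2 * ∏ i, B i ⬝ᵥ B i := by
  have hnn (i : m) : 0 ≤ B i ⬝ᵥ B i := by simpa using dotProduct_star_self_nonneg (B i)
  have hentry (i j : m) : |B i j| ≤ √(B i ⬝ᵥ B i) := by
    apply Real.abs_le_sqrt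
    rw [dotProduct, sq]
    exact single_le_sum (f := fun j => B i j * B i j) (fun _ _ => mul_self_nonneg _)
      (mem_univ j)
  have habs : |B.det| ≤ (Fintype.card m).factorial * ∏ i, √(B i ⬝ᵥ B i) := by
    rw [det_apply']
    calc
      _ ≤ ∑ σ : Equiv.Perm m, |((Equiv.Perm.sign σ : ℤ) : ℝ) * ∏ i, B (σ i) i| :=
        abs_sum_le_sum_abs _ _
      _ ≤ ∑ _σ : Equiv.Perm m, ∏ i, √(B i ⬝ᵥ B i) := by
        refine sum_le_sum fun σ _ => ?_
        rw [abs_mul, ← Int.cast_abs, Int.abs_eq_natAbs, Int.units_natAbs, abs_prod,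
          ← Equiv.prod_comp σ fun i => √(B i ⬝ᵥ B i)]
        simpa using prod_le_prod (fun _ _ => abs_nonneg _) fun i _ => hentry (σ i) i
      _ = _ := by simp [Fintype.card_perm]
  calc
    B.det ^ 2 = |B.det| ^ 2 := (sq_abs _).symm
    _ ≤ ((Fintype.card m).factorial * ∏ i, √(B i ⬝ᵥ B i)) ^ 2 := by gcongr
    _ = _ := by
      rw [mul_pow, ← prod_pow]
      simp only [Real.sq_sqrt (hnn _)]

/-- Every `r` rows with distinct indices are linearly independent. -/
def RowsInGeneralPosition {n r : ℕ} (U : Matrix (Fin n) (Fin r) ℝ) : Prop :=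
  ∀ g : Fin r → Fin n, Function.Injective g → (U.submatrix g id).det ≠ 0

theorem exists_rowsInGeneralPosition_of_sign {m : Type*} [Finite m] {n r : ℕ}
    (U : Matrix (Fin n) (Fin r) ℝ) (V : Matrix (Fin r) m ℝ) (H : Matrix (Fin n) m ℝ)
    (hsign : ∀ i j, 0 < (U * V) i j * H i j) :
    ∃ U' : Matrix (Fin n) (Fin r) ℝ, U'.RowsInGeneralPosition ∧
      ∀ i j, 0 < (U' * V) i j * H i j := by
  let W : Matrix (Fin n) (Fin r) ℝ := of fun i k => ((i : ℕ) : ℝ) ^ (k : ℕ)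
  have hdet : ∀ᶠ t in nhdsWithin (0 : ℝ) {0}ᶜ, (t • W + U).RowsInGeneralPosition := by
    refine Filter.eventually_all.2 fun g => Filter.eventually_imp_distrib_left.2 fun hg => ?_
    let p : Polynomial ℝ := det ((Polynomial.X : Polynomial ℝ) •
      (W.submatrix g id).map Polynomial.C + (U.submatrix g id).map Polynomial.C)
    have hp : p ≠ 0 := by
      intro h0
      have h := Polynomial.coeff_det_X_add_C_card (W.submatrix g id) (U.submatrix g id)
      change p.coeff _ = _ at h
      rw [h0, Polynomial.coeff_zero] at h
      have hW : W.submatrix g id = vandermonde fun k => (((g k : Fin n) : ℕ) : ℝ) := by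
        ext i j
        simp [W, vandermonde_apply]
      rw [hW] at h
      refine det_vandermonde_ne_zero_iff.2 (fun a b hab => hg ?_) h.symm
      exact Fin.ext (Nat.cast_injective hab)
    have heval (t : ℝ) : ((t • W + U).submatrix g id).det = p.eval t := by
      change _ = Polynomial.evalRingHom t p
      rw [RingHom.map_det]
      congr 1
      ext i j
      simp
      exact mul_comm _ _
    filter_upwards [nhdsNE_le_cofinite 0
      (Polynomial.finite_setOfPred_isRoot hp).compl_mem_cofinite] with t ht
    rw [heval]
    exact ht
  have hpos : ∀ᶠ t in nhdsWithin (0 : ℝ) {0}ᶜ, ∀ i j, 0 < ((t • W + U) * V) i j * H i j := by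
    refine Filter.eventually_all.2 fun i => Filter.eventually_all.2 fun j => ?_
    have hc : Continuous fun t : ℝ => ((t • W + U) * V) i j * H i j := by
      simp only [mul_apply, add_apply, smul_apply, smul_eq_mul]
      fun_prop
    exact (hc.continuousAt.eventually (lt_mem_nhds (by simpa using hsign i j))).filter_mono
      nhdsWithin_le_nhds
  obtain ⟨t, ht⟩ := (hdet.and hpos).exists
  exact ⟨_, ht⟩

theorem RowsInGeneralPosition.exists_pos_mul_det_le {n r : ℕ} [NeZero n] (hrn : r ≤ n)
    {U : Matrix (Fin n) (Fin r) ℝ} (hU : U.RowsInGeneralPosition) :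
    ∃ c > 0, ∀ A : Matrix (Fin r) (Fin r) ℝ,
      c * (A.det ^ 2) ^ n ≤ (∏ i, (A *ᵥ U i) ⬝ᵥ (A *ᵥ U i)) ^ r := by
  let g (i : Fin n) (k : Fin r) : Fin n := i + Fin.castLE hrn k
  have hg (i : Fin n) : Function.Injective (g i) := fun a b h =>
    Fin.castLE_injective hrn (add_left_cancel h)
  set q : ℝ := (r.factorial : ℝ) ^ 2
  have hq : 0 < q := by positivity
  let c : ℝ := ∏ i, (U.submatrix (g i) id).det ^ 2
  have hc : 0 < c := prod_pos fun i _ => sq_pos_of_ne_zero (hU _ (hg i))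
  refine ⟨c / q ^ n, by positivity, fun A => ?_⟩
  have hwin (i : Fin n) : (U.submatrix (g i) id).det ^ 2 * A.det ^ 2 ≤
      q * ∏ k, (A *ᵥ U (g i k)) ⬝ᵥ (A *ᵥ U (g i k)) := by
    have h := sq_det_le_sq_factorial_mul_prod_row (U.submatrix (g i) id * Aᵀ)
    have hrow (k : Fin r) : (U.submatrix (g i) id * Aᵀ) k = A *ᵥ U (g i k) := by
      ext l
      simp [mul_apply, mulVec, dotProduct, mul_comm]
    simpa only [hrow, det_mul, det_transpose, mul_pow, Fintype.card_fin] using h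
  have hprod := prod_le_prod (s := univ) (fun i _ => by positivity) fun i _ => hwin i
  have hshift : ∏ i, ∏ k, (A *ᵥ U (g i k)) ⬝ᵥ (A *ᵥ U (g i k)) =
      (∏ i, (A *ᵥ U i) ⬝ᵥ (A *ᵥ U i)) ^ r := by
    rw [prod_comm]
    have (k : Fin r) : ∏ i, (A *ᵥ U (g i k)) ⬝ᵥ (A *ᵥ U (g i k)) =
        ∏ i, (A *ᵥ U i) ⬝ᵥ (A *ᵥ U i) :=
      Equiv.prod_comp (Equiv.addRight (Fin.castLE hrn k))
        fun i => (A *ᵥ U i) ⬝ᵥ (A *ᵥ U i)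
    simp [this]
  rw [prod_mul_distrib, prod_mul_distrib, hshift] at hprod
  simp only [prod_const, card_univ, Fintype.card_fin] at hprod
  rw [div_mul_eq_mul_div, div_le_iff₀ (by positivity), mul_comm _ (q ^ n)]
  exact hprod

theorem dotProduct_self_pos {m : Type*} [Fintype m] {x : m → ℝ} (hx : x ≠ 0) : 0 < x ⬝ᵥ x := by
  simpa using dotProduct_star_self_pos_iff.2 hx

theorem exists_det_eq_and_forall_dotProduct_self {m : Type*} [Fintype m] [DecidableEq m]
    {s t : ℝ} (hst : (1 + s) ^ 2 = 1 + t) {x : m → ℝ} (hx : x ≠ 0) :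
    ∃ P : Matrix m m ℝ, P.det = 1 + s ∧
      ∀ v, (P *ᵥ v) ⬝ᵥ (P *ᵥ v) = v ⬝ᵥ v + t * ((v ⬝ᵥ x) ^ 2 / x ⬝ᵥ x) := by
  have hxx := dotProduct_self_pos hx
  refine ⟨1 + vecMulVec ((s / x ⬝ᵥ x) • x) x, ?_, fun v => ?_⟩
  · rw [vecMulVec_eq Unit, det_one_add_replicateCol_mul_replicateRow, dotProduct_smul,
      smul_eq_mul, div_mul_cancel₀ _ hxx.ne']
  · have ht : t = 2 * s + s ^ 2 := by linarith
    rw [add_mulVec, one_mulVec, vecMulVec_mulVec]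
    simp only [add_dotProduct, dotProduct_add, smul_dotProduct, dotProduct_smul, smul_eq_mul,
      op_smul_eq_smul, dotProduct_comm x v]
    rw [ht]
    field_simp
    ring

/-- The functional whose near-minimizers put the rows of `U` in nearly isotropic position. -/
noncomputable def rowPotential {n r : ℕ} (U : Matrix (Fin n) (Fin r) ℝ)
    (A : Matrix (Fin r) (Fin r) ℝ) : ℝ :=
  (∏ i, (A *ᵥ U i) ⬝ᵥ (A *ᵥ U i)) ^ r / (A.det ^ 2) ^ n

theorem mulVec_ne_zero_of_det_ne_zero {m K : Type*} [Fintype m] [DecidableEq m] [Field K]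
    {A : Matrix m m K} (hA : A.det ≠ 0) {v : m → K} (hv : v ≠ 0) : A *ᵥ v ≠ 0 :=
  fun h => hv (eq_zero_of_mulVec_eq_zero hA h)

theorem exists_rowPotential_le {n r : ℕ} {U : Matrix (Fin n) (Fin r) ℝ} (hU : ∀ i, U i ≠ 0)
    {t : ℝ} (ht : 0 < t) {A : Matrix (Fin r) (Fin r) ℝ} (hA : A.det ≠ 0) {x : Fin r → ℝ}
    (hx : r * ∑ i, ((A *ᵥ U i) ⬝ᵥ x) ^ 2 / (A *ᵥ U i) ⬝ᵥ (A *ᵥ U i) <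
      (1 - t) * n * x ⬝ᵥ x) :
    ∃ B : Matrix (Fin r) (Fin r) ℝ, B.det ≠ 0 ∧
      U.rowPotential B ≤ (Real.exp (t * (1 - t)) / (1 + t)) ^ n * U.rowPotential A := by
  have hN (i : Fin n) : 0 < (A *ᵥ U i) ⬝ᵥ (A *ᵥ U i) :=
    dotProduct_self_pos (mulVec_ne_zero_of_det_ne_zero hA (hU i))
  have hx0 : x ≠ 0 := by
    rintro rfl
    simp at hx
  have hxx := dotProduct_self_pos hx0
  have hst : (1 + (√(1 + t) - 1)) ^ 2 = 1 + t := by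
    rw [add_sub_cancel, Real.sq_sqrt (by positivity)]
  obtain ⟨P, hPdet, hP⟩ := exists_det_eq_and_forall_dotProduct_self hst hx0
  have hPsq : P.det ^ 2 = 1 + t := by rw [hPdet, hst]
  have hP0 : P.det ≠ 0 := by
    intro h
    rw [h] at hPsq
    linarith
  refine ⟨P * A, by rw [det_mul]; exact mul_ne_zero hP0 hA, ?_⟩
  let w (i : Fin n) : ℝ := ((A *ᵥ U i) ⬝ᵥ x) ^ 2 / (A *ᵥ U i) ⬝ᵥ (A *ᵥ U i)
  have hw (i : Fin n) : 0 ≤ w i := div_nonneg (sq_nonneg _) (hN i).le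
  have hnorm (i : Fin n) : ((P * A) *ᵥ U i) ⬝ᵥ ((P * A) *ᵥ U i) =
      (1 + t * (w i / x ⬝ᵥ x)) * (A *ᵥ U i) ⬝ᵥ (A *ᵥ U i) := by
    rw [← mulVec_mulVec, hP]
    have := (hN i).ne'
    simp only [w]
    field_simp
  have hsum : r * (∑ i, t * (w i / x ⬝ᵥ x)) ≤ n * (t * (1 - t)) := by
    rw [← mul_sum, ← sum_div]
    change r * ∑ i, w i < _ at hx
    calc
      r * (t * ((∑ i, w i) / x ⬝ᵥ x)) = t * ((r * ∑ i, w i) / x ⬝ᵥ x) := by ring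
      _ ≤ t * ((1 - t) * n) := by
        gcongr
        exact (div_le_iff₀ hxx).2 hx.le
      _ = _ := by ring
  have hprod : (∏ i, (1 + t * (w i / x ⬝ᵥ x))) ^ r ≤ Real.exp (t * (1 - t)) ^ n := by
    calc
      _ ≤ (∏ i, Real.exp (t * (w i / x ⬝ᵥ x))) ^ r := by
        have h0 (i : Fin n) : 0 ≤ t * (w i / x ⬝ᵥ x) :=
          mul_nonneg ht.le (div_nonneg (hw i) hxx.le)
        refine pow_le_pow_left₀ (prod_nonneg fun i _ => by linarith [h0 i]) ?_ _
        refine prod_le_prod (fun i _ => by linarith [h0 i]) fun i _ => ?_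
        linarith [Real.add_one_le_exp (t * (w i / x ⬝ᵥ x))]
      _ = Real.exp (r * ∑ i, t * (w i / x ⬝ᵥ x)) := by
        rw [← Real.exp_sum, ← Real.exp_nat_mul]
      _ ≤ _ := by
        rw [← Real.exp_nat_mul]
        exact Real.exp_le_exp.2 hsum
  simp only [rowPotential, hnorm, prod_mul_distrib, det_mul]
  rw [mul_pow, mul_pow, mul_pow, hPsq, div_pow, mul_div_mul_comm]
  have : 0 < 1 + t := by linarith
  gcongr
  exact div_nonneg (pow_nonneg (prod_nonneg fun i _ => (hN i).le) _) (by positivity)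

theorem RowsInGeneralPosition.exists_nearly_isotropic {n r : ℕ} [NeZero n] (hrn : r ≤ n)
    {U : Matrix (Fin n) (Fin r) ℝ} (hU : U.RowsInGeneralPosition) (hU0 : ∀ i, U i ≠ 0)
    {t : ℝ} (ht : 0 < t) (ht1 : t < 1) :
    ∃ A : Matrix (Fin r) (Fin r) ℝ, A.det ≠ 0 ∧ ∀ x : Fin r → ℝ,
      (1 - t) * n * x ⬝ᵥ x ≤
        r * ∑ i, ((A *ᵥ U i) ⬝ᵥ x) ^ 2 / (A *ᵥ U i) ⬝ᵥ (A *ᵥ U i) := by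
  by_contra! hcon
  obtain ⟨c, hc, hbound⟩ := hU.exists_pos_mul_det_le hrn
  set q : ℝ := (Real.exp (t * (1 - t)) / (1 + t)) ^ n
  have hq0 : 0 < q := by positivity
  have hq1 : q < 1 := by
    refine pow_lt_one₀ (by positivity) ?_ (NeZero.ne n)
    rw [div_lt_one (by positivity)]
    have h := Real.add_one_le_exp (-(t * (1 - t)))
    have he := Real.exp_pos (t * (1 - t))
    have hm : Real.exp (t * (1 - t)) * Real.exp (-(t * (1 - t))) = 1 := by
      rw [← Real.exp_add, add_neg_cancel, Real.exp_zero]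
    have h1 : 0 < (1 - t * (1 - t)) := by nlinarith
    have h2 : Real.exp (t * (1 - t)) * (1 - t * (1 - t)) ≤ 1 := by nlinarith
    have h3 : 1 < (1 + t) * (1 - t * (1 - t)) := by nlinarith [pow_pos ht 3]
    exact lt_of_mul_lt_mul_right (h2.trans_lt h3) h1.le
  let S : Set ℝ := U.rowPotential '' {A | A.det ≠ 0}
  have hne : S.Nonempty := ⟨_, 1, by simp, rfl⟩
  have hlow : ∀ y ∈ S, c ≤ y := by
    rintro _ ⟨A, hA, rfl⟩
    have hA' : 0 < A.det ^ 2 := sq_pos_of_ne_zero hA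
    exact (le_div_iff₀ (by positivity)).2 (hbound A)
  have hpos : 0 < sInf S := hc.trans_le (le_csInf hne hlow)
  obtain ⟨_, ⟨A, hA, rfl⟩, hAlt⟩ := exists_lt_of_csInf_lt hne
    ((lt_div_iff₀ hq0).2 (mul_lt_of_lt_one_right hpos hq1))
  obtain ⟨x, hx⟩ := hcon A hA
  obtain ⟨B, hB, hBle⟩ := exists_rowPotential_le hU0 ht hA hx
  have hinf : sInf S ≤ U.rowPotential B := csInf_le ⟨c, hlow⟩ ⟨B, hB, rfl⟩
  rw [lt_div_iff₀ hq0, mul_comm] at hAlt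
  linarith

/-- Lindsey's lemma for families of vectors of norm at most one. -/
theorem sq_sum_mul_dotProduct_le {ι κ : Type*} [Fintype ι] [DecidableEq ι] [Fintype κ]
    {r : ℕ} {H : Matrix ι κ ℝ} {a : ℝ} (ha : 0 ≤ a) (hH : H * Hᵀ = a • (1 : Matrix ι ι ℝ))
    {p : ι → Fin r → ℝ} {q : κ → Fin r → ℝ} (hp : ∀ i, p i ⬝ᵥ p i ≤ 1)
    (hq : ∀ j, q j ⬝ᵥ q j ≤ 1) :
    (∑ j, ∑ i, H i j * p i ⬝ᵥ q j) ^ 2 ≤ a * Fintype.card ι * Fintype.card κ := by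
  let P : Matrix ι (Fin r) ℝ := of p
  have hsum : ∑ j, ∑ i, H i j * p i ⬝ᵥ q j = ∑ x : κ × Fin r, (Hᵀ * P) x.1 x.2 * q x.1 x.2 := by
    simp only [Fintype.sum_prod_type, mul_apply, transpose_apply, dotProduct, mul_sum, sum_mul, P,
      of_apply, mul_assoc]
    exact sum_congr rfl fun j _ => sum_comm
  have hq' : ∑ x : κ × Fin r, q x.1 x.2 ^ 2 ≤ Fintype.card κ := by
    rw [Fintype.sum_prod_type]
    calc
      _ ≤ ∑ _j : κ, (1 : ℝ) := by
        refine sum_le_sum fun j _ => ?_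
        simpa [dotProduct, sq] using hq j
      _ = _ := by simp
  have hp' : ∑ x : κ × Fin r, (Hᵀ * P) x.1 x.2 ^ 2 ≤ a * Fintype.card ι := by
    have htr : ∑ x : κ × Fin r, (Hᵀ * P) x.1 x.2 ^ 2 = ((Hᵀ * P)ᵀ * (Hᵀ * P)).trace := by
      simp only [trace, diag, mul_apply (M := (Hᵀ * P)ᵀ), transpose_apply (Hᵀ * P),
        Fintype.sum_prod_type, sq]
      exact sum_comm
    have hmul : (Hᵀ * P)ᵀ * (Hᵀ * P) = a • (Pᵀ * P) := by
      rw [transpose_mul, transpose_transpose, Matrix.mul_assoc, ← Matrix.mul_assoc H, hH]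
      simp
    rw [htr, hmul, trace_smul, smul_eq_mul]
    gcongr
    calc
      (Pᵀ * P).trace = ∑ i, p i ⬝ᵥ p i := by
        simp only [trace, diag, mul_apply, transpose_apply, dotProduct, P, of_apply]
        exact sum_comm
      _ ≤ ∑ _i : ι, (1 : ℝ) := sum_le_sum fun i _ => hp i
      _ = _ := by simp
  rw [hsum]
  refine (sum_mul_sq_le_sq_mul_sq _ _ _).trans ?_
  gcongr

/-- **Forster's theorem** for Hadamard sign patterns, in factored form. -/
theorem le_sq_of_hadamard_sign_mul {n r : ℕ} [NeZero n] (hrn : r ≤ n)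
    {H : Matrix (Fin n) (Fin n) ℝ} (hH : H * Hᵀ = (n : ℝ) • (1 : Matrix (Fin n) (Fin n) ℝ))
    (hH1 : ∀ i j, |H i j| = 1) (U : Matrix (Fin n) (Fin r) ℝ) (V : Matrix (Fin r) (Fin n) ℝ)
    (hU : U.RowsInGeneralPosition) (hsign : ∀ i j, 0 < (U * V) i j * H i j) :
    n ≤ r ^ 2 := by
  have hn : (0 : ℝ) < n := Nat.cast_pos.2 (NeZero.pos n)
  have hUV (i j : Fin n) : (U * V) i j = U i ⬝ᵥ Vᵀ j := rfl
  have hU0 (i : Fin n) : U i ≠ 0 := fun h => by simpa [hUV, h] using hsign i 0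
  have hV0 (j : Fin n) : Vᵀ j ≠ 0 := fun h => by simpa [hUV, h] using hsign 0 j
  have key (t : ℝ) (ht : 0 < t) (ht1 : t < 1) : (1 - t) ^ 2 * n ≤ r ^ 2 := by
    obtain ⟨A, hA, hiso⟩ := hU.exists_nearly_isotropic hrn hU0 ht ht1
    let u (i : Fin n) : Fin r → ℝ := A *ᵥ U i
    let v (j : Fin n) : Fin r → ℝ := A⁻¹ᵀ *ᵥ Vᵀ j
    have hu (i : Fin n) : 0 < u i ⬝ᵥ u i :=
      dotProduct_self_pos (mulVec_ne_zero_of_det_ne_zero hA (hU0 i))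
    have hAinv : IsUnit A.det := isUnit_iff_ne_zero.2 hA
    have hv (j : Fin n) : 0 < v j ⬝ᵥ v j := by
      refine dotProduct_self_pos (mulVec_ne_zero_of_det_ne_zero ?_ (hV0 j))
      rw [det_transpose]
      exact (A.isUnit_nonsing_inv_det hAinv).ne_zero
    have huv (i j : Fin n) : u i ⬝ᵥ v j = (U * V) i j := by
      rw [hUV, dotProduct_mulVec, vecMul_transpose, mulVec_mulVec, nonsing_inv_mul _ hAinv,
        one_mulVec]
    let p (i : Fin n) : Fin r → ℝ := (√(u i ⬝ᵥ u i))⁻¹ • u i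
    let q (j : Fin n) : Fin r → ℝ := (√(v j ⬝ᵥ v j))⁻¹ • v j
    have hunit {x : Fin r → ℝ} (hx : 0 < x ⬝ᵥ x) :
        ((√(x ⬝ᵥ x))⁻¹ • x) ⬝ᵥ ((√(x ⬝ᵥ x))⁻¹ • x) = 1 := by
      rw [smul_dotProduct, dotProduct_smul, smul_eq_mul, smul_eq_mul, ← mul_assoc, ← mul_inv,
        Real.mul_self_sqrt hx.le, inv_mul_cancel₀ hx.ne']
    have hp (i : Fin n) : p i ⬝ᵥ p i = 1 := hunit (hu i)
    have hq (j : Fin n) : q j ⬝ᵥ q j = 1 := hunit (hv j)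
    have hpq (i j : Fin n) : p i ⬝ᵥ q j =
        (√(u i ⬝ᵥ u i))⁻¹ * (√(v j ⬝ᵥ v j))⁻¹ * (U * V) i j := by
      simp only [p, q, smul_dotProduct, dotProduct_smul, smul_eq_mul, huv]
      ring
    have hpos (i j : Fin n) : 0 < H i j * p i ⬝ᵥ q j := by
      have h1 := Real.sqrt_pos.2 (hu i)
      have h2 := Real.sqrt_pos.2 (hv j)
      rw [hpq, mul_comm, mul_assoc]
      exact mul_pos (by positivity) (hsign i j)
    have hle (i j : Fin n) : (p i ⬝ᵥ q j) ^ 2 ≤ H i j * p i ⬝ᵥ q j := by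
      have hcs : (p i ⬝ᵥ q j) ^ 2 ≤ 1 := by
        have h := sum_mul_sq_le_sq_mul_sq univ (p i) (q j)
        have h1 := hp i
        have h2 := hq j
        simp only [dotProduct, ← sq] at h1 h2 ⊢
        rwa [h1, h2, one_mul] at h
      rw [← abs_of_pos (hpos i j), abs_mul, hH1, one_mul, ← sq_abs, sq]
      exact mul_le_of_le_one_left (abs_nonneg _) ((sq_le_one_iff_abs_le_one _).1 hcs)
    have hcol (j : Fin n) : (1 - t) * n ≤ r * ∑ i, H i j * p i ⬝ᵥ q j := by
      calc
        (1 - t) * n = (1 - t) * n * q j ⬝ᵥ q j := by rw [hq, mul_one]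
        _ ≤ _ := hiso (q j)
        _ = r * ∑ i, (p i ⬝ᵥ q j) ^ 2 := by
          congr 1
          refine sum_congr rfl fun i _ => ?_
          simp only [p, smul_dotProduct, smul_eq_mul, mul_pow, inv_pow, Real.sq_sqrt (hu i).le]
          exact div_eq_inv_mul _ _
        _ ≤ _ := by
          gcongr with i
          exact hle i j
    have hsum : (1 - t) * n * n ≤ r * ∑ j, ∑ i, H i j * p i ⬝ᵥ q j := by
      have h := sum_le_sum fun j (_ : j ∈ univ) => hcol j
      rw [sum_const, card_univ, Fintype.card_fin, nsmul_eq_mul, ← mul_sum] at h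
      linarith
    have hlindsey := sq_sum_mul_dotProduct_le hn.le hH (fun i => (hp i).le) fun j => (hq j).le
    rw [Fintype.card_fin] at hlindsey
    have h0 : 0 ≤ (1 - t) * n * n := by
      have := sub_pos.2 ht1
      positivity
    have hsq := pow_le_pow_left₀ h0 hsum 2
    rw [mul_pow (r : ℝ)] at hsq
    have h := hsq.trans (mul_le_mul_of_nonneg_left hlindsey (sq_nonneg (r : ℝ)))
    refine le_of_mul_le_mul_right ?_ (pow_pos hn 3)
    linarith
  have hlim : Filter.Tendsto (fun t : ℝ => (1 - t) ^ 2 * (n : ℝ)) (nhdsWithin 0 (Set.Ioi 0))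
      (nhds (n : ℝ)) := by
    have hc : Continuous fun t : ℝ => (1 - t) ^ 2 * (n : ℝ) := by fun_prop
    simpa using (hc.tendsto 0).mono_left nhdsWithin_le_nhds
  have hreal : (n : ℝ) ≤ r ^ 2 := by
    refine le_of_tendsto hlim ?_
    filter_upwards [Ioo_mem_nhdsGT one_pos] with t ht
    exact key t ht.1 ht.2
  exact_mod_cast hreal

/-- The sign rank of a Hadamard matrix of order `n` is at least `√n`. -/
theorem le_sq_rank_of_hadamard_sign {n : ℕ} [NeZero n]
    {H : Matrix (Fin n) (Fin n) ℝ} (hH : H * Hᵀ = (n : ℝ) • (1 : Matrix (Fin n) (Fin n) ℝ))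
    (hH1 : ∀ i j, |H i j| = 1) (X : Matrix (Fin n) (Fin n) ℝ)
    (hsign : ∀ i j, 0 < X i j * H i j) : n ≤ X.rank ^ 2 := by
  obtain ⟨U, V, hUV⟩ := X.exists_mul_eq_of_rank
  have hrn : X.rank ≤ n := by simpa using X.rank_le_width
  rw [← hUV] at hsign
  obtain ⟨U', hU', hsign'⟩ := exists_rowsInGeneralPosition_of_sign U V H hsign
  exact le_sq_of_hadamard_sign_mul hrn hH hH1 U' V hU' hsign'

end Matrix

theorem abs_sylvester (k : ℕ) (i j : Fin (2 ^ k)) : |sylvester k i j| = 1 := by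
  induction k with
  | zero =>
    obtain rfl : i = j := Fin.ext (by omega)
    rw [sylvester, one_apply_eq, abs_one]
  | succ k ih =>
    rw [sylvester, reindex_apply, submatrix_apply]
    generalize Equiv.symm _ i = a
    generalize Equiv.symm _ j = b
    rcases a with a | a <;> rcases b with b | b <;> simp [ih]

theorem sylvester_mul_transpose (k : ℕ) :
    sylvester k * (sylvester k)ᵀ =
      ((2 ^ k : ℕ) : ℝ) • (1 : Matrix (Fin (2 ^ k)) (Fin (2 ^ k)) ℝ) := by
  induction k with
  | zero => simp [sylvester]
  | succ k ih =>
    rw [sylvester, transpose_reindex, reindex_apply, reindex_apply, submatrix_mul_equiv,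
      fromBlocks_transpose, fromBlocks_multiply]
    simp only [transpose_neg, Matrix.mul_neg, Matrix.neg_mul, neg_neg, ih, add_neg_cancel,
      ← add_smul]
    have hblock (a : ℝ) : fromBlocks (a • (1 : Matrix (Fin (2 ^ k)) (Fin (2 ^ k)) ℝ)) 0 0
        (a • (1 : Matrix (Fin (2 ^ k)) (Fin (2 ^ k)) ℝ)) = a • 1 := by
      rw [← fromBlocks_one, fromBlocks_smul, smul_zero]
    rw [hblock]
    ext i j
    simp only [submatrix_apply, Matrix.smul_apply, one_apply, EmbeddingLike.apply_eq_iff_eq,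
      pow_succ, mul_two, Nat.cast_add]

/-- For `n = 2^k`, every real `n × n` matrix `X` whose sign pattern
equals the Sylvester Hadamard matrix `H_n` satisfies `rank X ≥ √n`. -/
theorem hadamard_sign_pattern_rank (k : ℕ) (X : Matrix (Fin (2 ^ k)) (Fin (2 ^ k)) ℝ)
    (hsign : ∀ i j, X i j * sylvester k i j > 0) :
    Real.sqrt ((2 ^ k : ℕ) : ℝ) ≤ (X.rank : ℝ) := by
  have h := le_sq_rank_of_hadamard_sign (sylvester_mul_transpose k) (abs_sylvester k) X hsign
  rw [Real.sqrt_le_left (Nat.cast_nonneg _)]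
  exact_mod_cast h
end
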